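/- arXiv:1405.6808 — 2 statements merged into one kernel-verified Lean document; each statement's English description precedes it below -/
import Mathlib

section
/- Let m ≥ 1 and suppose that f : [0,1]^m → ℂ is a symmetric integrable function such that ∫_{A_1×⋯×A_m} f = 0 for every partition of [0,1] into m pairwise disjoint measurable sets A_1,…,A_m with λ(A_1) = ⋯ = λ(A_m) = 1/m. Then there exists an integrable function g : [0,1] → ℂ with ∫₀¹ g = 0 such that f(x_1,…,x_m) = g(x_1) + ⋯ + g(x_m) for almost every (x_1,…,x_m) ∈ [0,1]^m. -/
open Filter Finset Asymptotics MeasureTheory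

section Boxes

variable {ι V : Type*} [Fintype ι] [DecidableEq ι]

/-- The sum of `a` over the box `∏ i, A i`. -/
def boxSum (a : (ι → V) → ℂ) (A : ι → Finset V) : ℂ := ∑ x ∈ Fintype.piFinset A, a x

theorem boxSum_update [DecidableEq V] (a : (ι → V) → ℂ) (A : ι → Finset V) (k : ι) (B : Finset V) :
    boxSum a (Function.update A k B) = ∑ v ∈ B, boxSum a (Function.update A k {v}) := by
  unfold boxSum
  rw [← Finset.sum_fiberwise_of_maps_to (g := fun x : ι → V => x k) (t := B)]
  · refine Finset.sum_congr rfl fun v hv => Finset.sum_congr ?_ fun _ _ => rfl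
    ext x
    simp only [Finset.mem_filter, Fintype.mem_piFinset]
    constructor
    · rintro ⟨h, rfl⟩ l
      by_cases hl : l = k
      · subst hl; simp
      · simpa [hl] using h l
    · intro h
      have hk : x k = v := by simpa using h k
      refine ⟨fun l => ?_, hk⟩
      by_cases hl : l = k
      · subst hl; simpa [hk] using hv
      · simpa [hl] using h l
  · intro x hx
    simpa using Fintype.mem_piFinset.1 hx k

theorem boxSum_singleton (a : (ι → V) → ℂ) (x : ι → V) : boxSum a (fun k => {x k}) = a x := by
  simp [boxSum]

theorem boxSum_comp_perm {a : (ι → V) → ℂ} (ha : ∀ (σ : Equiv.Perm ι) x, a (fun i => x (σ i)) = a x)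
    (σ : Equiv.Perm ι) (A : ι → Finset V) : boxSum a (fun i => A (σ i)) = boxSum a A := by
  unfold boxSum
  symm
  refine Finset.sum_equiv (Equiv.arrowCongr σ.symm (Equiv.refl V)) (fun x => ?_) (fun x _ => ?_)
  · simp only [Fintype.mem_piFinset, Equiv.arrowCongr_apply, Function.comp, Equiv.symm_symm,
      Equiv.refl_apply]
    exact ⟨fun h i => h _, fun h i => by simpa using h (σ.symm i)⟩
  · exact (ha σ x).symm

theorem boxSum_update_comm {a : (ι → V) → ℂ}
    (ha : ∀ (σ : Equiv.Perm ι) x, a (fun i => x (σ i)) = a x) {i j : ι} (hij : i ≠ j)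
    (C : ι → Finset V) (A B : Finset V) :
    boxSum a (Function.update (Function.update C i A) j B) =
      boxSum a (Function.update (Function.update C i B) j A) := by
  rw [← boxSum_comp_perm ha (Equiv.swap i j)]
  congr 1
  funext l
  rcases eq_or_ne l i with rfl | hi
  · simp [hij]
  rcases eq_or_ne l j with rfl | hj
  · simp [hij]
  · simp [Equiv.swap_apply_of_ne_of_ne hi hj, hi, hj]

theorem boxSum_update_update_singleton (a : (ι → V) → ℂ) (w : ι → V) (i j : ι) (u v : V) :
    boxSum a (Function.update (Function.update (fun k => {w k}) i {u}) j {v}) =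
      a (Function.update (Function.update w i u) j v) := by
  refine Eq.trans (congrArg (boxSum a) (funext fun l => ?_)) (boxSum_singleton a _)
  rcases eq_or_ne l j with rfl | hj
  · simp
  rcases eq_or_ne l i with rfl | hi
  · simp [hj]
  · simp [hi, hj]

end Boxes

section Combinatorics

variable {ι V : Type*} [DecidableEq ι] [DecidableEq V]

theorem eq_zero_of_sum_subset_eq_zero {g : V → ℂ} {W : Finset V} {N : ℕ} (hN : 1 ≤ N)
    (hW : N + 1 ≤ #W) (h : ∀ A ⊆ W, #A = N → ∑ v ∈ A, g v = 0) {x : V} (hx : x ∈ W) :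
    g x = 0 := by
  have key : ∀ y ∈ W, g y = g x := by
    intro y hy
    rcases eq_or_ne y x with rfl | hxy
    · rfl
    obtain ⟨A, hA, hAc⟩ : ∃ A ⊆ (W.erase x).erase y, #A = N - 1 := by
      apply Finset.exists_subset_card_eq
      rw [Finset.card_erase_of_mem (by simp [hxy, hy]), Finset.card_erase_of_mem hx]
      omega
    have hxA : x ∉ A := fun hh => by simpa using hA hh
    have hyA : y ∉ A := fun hh => by simpa using hA hh
    have hAW : A ⊆ W := fun v hv => by
      have := hA hv
      simp only [Finset.mem_erase] at this
      exact this.2.2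
    have h1 := h (insert x A) (Finset.insert_subset hx hAW)
      (by rw [Finset.card_insert_of_notMem hxA]; omega)
    have h2 := h (insert y A) (Finset.insert_subset hy hAW)
      (by rw [Finset.card_insert_of_notMem hyA]; omega)
    rw [Finset.sum_insert hxA] at h1
    rw [Finset.sum_insert hyA] at h2
    linear_combination h2 - h1
  obtain ⟨A, hA, hAc⟩ := Finset.exists_subset_card_eq (s := W) (n := N) (by omega)
  have h1 := h A hA hAc
  rw [Finset.sum_congr rfl fun v hv => key v (hA hv), Finset.sum_const, hAc, nsmul_eq_mul] at h1
  have : (N : ℂ) ≠ 0 := by exact_mod_cast (by omega : N ≠ 0)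
  simpa [this] using h1

/-- A form additive in the slots of `K` which vanishes on disjoint `N`-sets of a large enough set
vanishes on distinct points. -/
theorem eq_zero_of_forall_card_eq {D : (ι → Finset V) → ℂ} {K : Finset ι}
    (hD : ∀ C, ∀ k ∈ K, ∀ B, D (Function.update C k B) = ∑ v ∈ B, D (Function.update C k {v}))
    {W : Finset V} {N : ℕ} (hN : 1 ≤ N) (hW : #K * N + 1 ≤ #W)
    (h : ∀ C : ι → Finset V, (∀ k ∈ K, C k ⊆ W) → (∀ k ∈ K, #(C k) = N) →
      (K : Set ι).PairwiseDisjoint C → D C = 0) (S : Finset ι) (C : ι → Finset V)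
    (hCW : ∀ k ∈ K, C k ⊆ W) (hC : ∀ k ∈ K, #(C k) = if k ∈ S then 1 else N)
    (hdisj : (K : Set ι).PairwiseDisjoint C) : D C = 0 := by
  induction S using Finset.induction_on generalizing C with
  | empty => exact h C hCW (by simpa using hC) hdisj
  | insert k S hk ih =>
    by_cases hkK : k ∈ K
    · set W' := W \ (K.erase k).biUnion C with hW'
      have hcard : N + 1 ≤ #W' := by
        have h1 : #((K.erase k).biUnion C) ≤ #(K.erase k) * N := by
          apply Finset.card_biUnion_le_card_mul
          intro l hl
          rw [hC l (Finset.mem_of_mem_erase hl)]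
          split_ifs <;> omega
        have h2 := Finset.le_card_sdiff ((K.erase k).biUnion C) W
        have h3 : #(K.erase k) + 1 = #K := Finset.card_erase_add_one hkK
        have h4 : #K * N = #(K.erase k) * N + N := by rw [← h3]; ring
        rw [← hW'] at h2
        omega
      have hCk : #(C k) = 1 := by simpa using hC k hkK
      obtain ⟨v, hv⟩ := Finset.card_eq_one.1 hCk
      have hvW : v ∈ W' := by
        simp only [hW', Finset.mem_sdiff, Finset.mem_biUnion, not_exists, not_and]
        refine ⟨hCW k hkK (by simp [hv]), fun l hl hvl => ?_⟩
        have hlK := Finset.mem_of_mem_erase hl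
        exact Finset.disjoint_left.1 (hdisj hlK hkK (Finset.ne_of_mem_erase hl)) hvl (by simp [hv])
      have := eq_zero_of_sum_subset_eq_zero (g := fun v => D (Function.update C k {v})) hN hcard
        (fun A hA hAc => ?_) hvW
      · rwa [← hv, Function.update_eq_self] at this
      · rw [← hD C k hkK]
        have hAl : ∀ l ∈ K, l ≠ k → Disjoint A (C l) := fun l hl hlk =>
          Finset.disjoint_left.2 fun w hw hwl => by
            have := hA hw
            simp only [hW', Finset.mem_sdiff, Finset.mem_biUnion, not_exists, not_and] at this
            exact this.2 l (Finset.mem_erase.2 ⟨hlk, hl⟩) hwl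
        apply ih
        · intro l hl
          rcases eq_or_ne l k with rfl | hlk
          · simpa using hA.trans Finset.sdiff_subset
          · simpa [hlk] using hCW l hl
        · intro l hl
          rcases eq_or_ne l k with rfl | hlk
          · simpa [hk] using hAc
          · simpa [hlk] using hC l hl
        · intro l hl l' hl' hll
          rcases eq_or_ne l k with rfl | hlk
          · simpa [Function.onFun, hll.symm] using hAl l' hl' hll.symm
          rcases eq_or_ne l' k with rfl | hlk'
          · simpa [Function.onFun, hlk] using (hAl l hl hlk).symm
          · simpa [Function.onFun, hlk, hlk'] using hdisj hl hl' hll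
    · refine ih C hCW (fun l hl => ?_) hdisj
      have : l ≠ k := fun e => hkK (e ▸ hl)
      simpa [this] using hC l hl

theorem sum_bisection_insert {b : V → V → ℂ} {A R Z : Finset V} {N : ℕ} (hN : 2 ≤ N)
    (h : ∀ A ⊆ R, #A = N → ∑ u ∈ A, ∑ v ∈ R \ A, b u v = 0) (hA : A ⊆ Z) (hAc : #A = N - 2)
    {p q p' q' : V} (h1 : p ≠ q) (h2 : p ≠ p') (h3 : p ≠ q') (h4 : q ≠ p') (h5 : q ≠ q')
    (h6 : p' ≠ q') (hp : p ∉ Z) (hq : q ∉ Z) (hp' : p' ∉ Z) (hq' : q' ∉ Z)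
    (hRe : R = insert p (insert q (insert p' (insert q' Z)))) :
    (∑ u ∈ A, ∑ v ∈ Z \ A, b u v + ∑ u ∈ A, b u p' + ∑ u ∈ A, b u q') +
      (∑ v ∈ Z \ A, b p v + b p p' + b p q') + (∑ v ∈ Z \ A, b q v + b q p' + b q q') = 0 := by
  have hpA : p ∉ A := fun e => hp (hA e)
  have hqA : q ∉ A := fun e => hq (hA e)
  have e1 : R \ insert p (insert q A) = insert p' (insert q' (Z \ A)) := by
    rw [hRe]; ext v
    simp only [Finset.mem_insert, Finset.mem_sdiff]
    have hA' : v ∈ A → v ∈ Z := fun e => hA e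
    grind
  have := h (insert p (insert q A)) ?_ ?_
  · rw [e1] at this
    rw [Finset.sum_insert (by simp [h1, hpA]), Finset.sum_insert hqA] at this
    have s : ∀ u, ∑ v ∈ insert p' (insert q' (Z \ A)), b u v =
        b u p' + (b u q' + ∑ v ∈ Z \ A, b u v) := fun u => by
      rw [Finset.sum_insert (by simp [h6, hp']), Finset.sum_insert (by simp [hq'])]
    simp only [s, Finset.sum_add_distrib] at this
    linear_combination this
  · rw [hRe]
    intro v hv
    simp only [Finset.mem_insert] at hv ⊢
    rcases hv with hv | hv | hv
    · simp [hv]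
    · simp [hv]
    · simp [hA hv]
  · rw [Finset.card_insert_of_notMem (by simp [h1, hpA]), Finset.card_insert_of_notMem hqA]
    omega

theorem four_term_of_bisection {b : V → V → ℂ} (hb : ∀ u v, b u v = b v u) {R : Finset V} {N : ℕ}
    (hR : #R = 2 * N) (hN : 2 ≤ N)
    (h : ∀ A ⊆ R, #A = N → ∑ u ∈ A, ∑ v ∈ R \ A, b u v = 0) {x y x' y' : V}
    (hnd : [x, y, x', y'].Nodup) (hx : x ∈ R) (hy : y ∈ R) (hx' : x' ∈ R) (hy' : y' ∈ R) :
    b x x' - b y x' - b x y' + b y y' = 0 := by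
  simp only [List.nodup_cons, List.mem_cons, List.not_mem_nil, not_or, or_false, not_false_eq_true,
    List.nodup_nil, and_true] at hnd
  obtain ⟨⟨h1, h2, h3⟩, ⟨h4, h5⟩, h6⟩ := hnd
  obtain ⟨Z, hZ⟩ : ∃ Z, Z = (((R.erase x).erase y).erase x').erase y' := ⟨_, rfl⟩
  have hZc : #Z = 2 * N - 4 := by
    rw [hZ, Finset.card_erase_of_mem, Finset.card_erase_of_mem, Finset.card_erase_of_mem,
      Finset.card_erase_of_mem hx, hR]
    · omega
    all_goals grind
  obtain ⟨A, hA, hAc⟩ := Finset.exists_subset_card_eq (s := Z) (n := N - 2) (by omega)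
  have hZR : R = insert x (insert y (insert x' (insert y' Z))) := by
    ext v; simp only [hZ, Finset.mem_insert, Finset.mem_erase]
    grind
  have hZx : x ∉ Z := by simp [hZ]
  have hZy : y ∉ Z := by simp [hZ]
  have hZx' : x' ∉ Z := by simp [hZ]
  have hZy' : y' ∉ Z := by simp [hZ]
  have m1 := sum_bisection_insert hN h hA hAc h2 h1 h3 (Ne.symm h4) h6 h5 hZx hZx' hZy hZy'
    (by rw [hZR]; ext; simp only [Finset.mem_insert]; tauto)
  have m2 := sum_bisection_insert hN h hA hAc h4 (Ne.symm h1) h5 (Ne.symm h2) h6 h3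
    hZy hZx' hZx hZy'
    (by rw [hZR]; ext; simp only [Finset.mem_insert]; tauto)
  have m3 := sum_bisection_insert hN h hA hAc h3 h1 h2 (Ne.symm h5) (Ne.symm h6) h4
    hZx hZy' hZy hZx'
    (by rw [hZR]; ext; simp only [Finset.mem_insert]; tauto)
  have m4 := sum_bisection_insert hN h hA hAc h5 (Ne.symm h1) h4 (Ne.symm h3) (Ne.symm h6) h2
    hZy hZy' hZx hZx'
    (by rw [hZR]; ext; simp only [Finset.mem_insert]; tauto)
  rw [hb x' x, hb x' y] at *
  rw [hb y' x, hb y' y] at *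
  linear_combination (-1 / 2 : ℂ) * (m1 - m2 - m3 + m4)

end Combinatorics

section FourTerm

variable {ι V : Type*} [Fintype ι] [DecidableEq ι] [Fintype V] [DecidableEq V]

theorem boxSum_four_term_of_disjoint {a : (ι → V) → ℂ}
    (ha : ∀ (σ : Equiv.Perm ι) x, a (fun i => x (σ i)) = a x) {N : ℕ} (hN : 2 ≤ N)
    (h : ∀ A : ι → Finset V, (∀ i j, i ≠ j → Disjoint (A i) (A j)) → (∀ i, #(A i) = N) →
      boxSum a A = 0) {i j : ι} (hij : i ≠ j) {K : Finset ι} (hK : ∀ k, k ∈ K ↔ k ≠ i ∧ k ≠ j)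
    (hcV : Fintype.card V = #K * N + 2 * N) {x y x' y' : V} (hnd : [x, y, x', y'].Nodup)
    {C : ι → Finset V} (hCW : ∀ k ∈ K, ∀ v ∈ C k, v ∉ [x, y, x', y'])
    (hCc : ∀ k ∈ K, #(C k) = N) (hCd : (K : Set ι).PairwiseDisjoint C) :
    boxSum a (Function.update (Function.update C i {x}) j {x'}) -
      boxSum a (Function.update (Function.update C i {y}) j {x'}) -
      boxSum a (Function.update (Function.update C i {x}) j {y'}) +
      boxSum a (Function.update (Function.update C i {y}) j {y'}) = 0 := by
  set R : Finset V := Finset.univ \ K.biUnion C with hRdef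
  have hR : #R = 2 * N := by
    rw [hRdef, Finset.card_sdiff_of_subset (Finset.subset_univ _), Finset.card_univ,
      Finset.card_biUnion hCd, Finset.sum_congr rfl hCc, Finset.sum_const, smul_eq_mul, hcV]
    omega
  have hmem : ∀ v ∈ [x, y, x', y'], v ∈ R := by
    intro v hv
    simp only [hRdef, Finset.mem_sdiff, Finset.mem_univ, true_and, Finset.mem_biUnion, not_exists,
      not_and]
    intro k hk hvk
    exact hCW k hk v hvk hv
  refine four_term_of_bisection (R := R) (N := N)
    (b := fun u v => boxSum a (Function.update (Function.update C i {u}) j {v}))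
    ?_ hR (by omega) ?_ hnd (hmem _ (by simp)) (hmem _ (by simp))
    (hmem _ (by simp)) (hmem _ (by simp))
  · intro u v
    exact boxSum_update_comm ha hij C _ _
  · intro A hA hAc
    have e : ∑ u ∈ A, ∑ v ∈ R \ A,
          boxSum a (Function.update (Function.update C i {u}) j {v}) =
        boxSum a (Function.update (Function.update C i A) j (R \ A)) := by
      rw [boxSum_update, Finset.sum_comm]
      refine Finset.sum_congr rfl fun v _ => ?_
      rw [Function.update_comm hij, boxSum_update]
      refine Finset.sum_congr rfl fun u _ => ?_
      rw [Function.update_comm hij.symm]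
    have hdR : ∀ k, k ≠ i → k ≠ j → Disjoint R (C k) := fun k hi hj =>
      Finset.disjoint_left.2 fun v hv hvk => by
        simp only [hRdef, Finset.mem_sdiff, Finset.mem_univ, true_and, Finset.mem_biUnion,
          not_exists, not_and] at hv
        exact hv k ((hK k).2 ⟨hi, hj⟩) hvk
    have hdA := fun k hi hj => (hdR k hi hj).mono_left hA
    have hdA' := fun k hi hj => (hdR k hi hj).mono_left (Finset.sdiff_subset (s := R) (t := A))
    have hAA : Disjoint A (R \ A) := Finset.disjoint_sdiff
    rw [e]
    apply h
    · intro k l hkl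
      rcases eq_or_ne k j with rfl | hkj
      · rcases eq_or_ne l i with rfl | hli
        · simpa [hkl.symm] using hAA.symm
        · simpa [hkl.symm, hli] using hdA' l hli hkl.symm
      rcases eq_or_ne k i with rfl | hki
      · rcases eq_or_ne l j with rfl | hlj
        · simpa [hkl] using hAA
        · simpa [hkj, hlj, hkl.symm] using hdA l hkl.symm hlj
      rcases eq_or_ne l j with rfl | hlj
      · simpa [hkj, hki] using (hdA' k hki hkj).symm
      rcases eq_or_ne l i with rfl | hli
      · simpa [hkj, hki, hlj] using (hdA k hki hkj).symm
      · simpa [hkj, hki, hlj, hli] using hCd ((hK k).2 ⟨hki, hkj⟩) ((hK l).2 ⟨hli, hlj⟩) hkl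
    · intro k
      rcases eq_or_ne k j with rfl | hkj
      · simp only [Function.update_self]
        rw [Finset.card_sdiff_of_subset hA]
        omega
      rcases eq_or_ne k i with rfl | hki
      · simpa [hkj] using hAc
      · simpa [hkj, hki] using hCc k ((hK k).2 ⟨hki, hkj⟩)

theorem four_term_of_boxSum_eq_zero {a : (ι → V) → ℂ}
    (ha : ∀ (σ : Equiv.Perm ι) x, a (fun i => x (σ i)) = a x) {N : ℕ} (hN : 3 ≤ N)
    (hV : Fintype.card V = Fintype.card ι * N)
    (h : ∀ A : ι → Finset V, (∀ i j, i ≠ j → Disjoint (A i) (A j)) → (∀ i, #(A i) = N) →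
      boxSum a A = 0) {i j : ι} (hij : i ≠ j) (w : ι → V) {x y x' y' : V}
    (hnd : [x, y, x', y'].Nodup) (hw : ∀ k, k ≠ i → k ≠ j → w k ∉ [x, y, x', y'])
    (hinj : ∀ k l, k ≠ i → k ≠ j → l ≠ i → l ≠ j → w k = w l → k = l) :
    a (Function.update (Function.update w i x) j x') -
      a (Function.update (Function.update w i y) j x') -
      a (Function.update (Function.update w i x) j y') +
      a (Function.update (Function.update w i y) j y') = 0 := by
  let b : (ι → Finset V) → V → V → ℂ := fun C u v =>
    boxSum a (Function.update (Function.update C i {u}) j {v})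
  have hb : ∀ u v, b (fun k => {w k}) u v = a (Function.update (Function.update w i u) j v) := by
    intro u v
    exact boxSum_update_update_singleton a w i j u v
  simp only [← hb]
  have hbD : ∀ (C : ι → Finset V) k, k ≠ i → k ≠ j → ∀ B u v,
      b (Function.update C k B) u v = ∑ q ∈ B, b (Function.update C k {q}) u v := by
    intro C k hi hj B u v
    simp only [b, Function.update_comm hi, Function.update_comm hj]
    exact boxSum_update _ _ _ _
  let K : Finset ι := (Finset.univ.erase i).erase j
  have hK : ∀ k, k ∈ K ↔ k ≠ i ∧ k ≠ j := fun k => by simp [K, and_comm]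
  have hKc : #K + 2 = Fintype.card ι := by
    have h1 : #((Finset.univ.erase i).erase j) + 1 = #((Finset.univ : Finset ι).erase i) :=
      Finset.card_erase_add_one (by simp [hij.symm])
    have h2 := Finset.card_erase_add_one (Finset.mem_univ i)
    rw [Finset.card_univ] at h2
    simp only [K]
    omega
  have hcV : Fintype.card V = #K * N + 2 * N := by rw [hV, ← hKc]; ring
  let W : Finset V := Finset.univ \ [x, y, x', y'].toFinset
  refine eq_zero_of_forall_card_eq (K := K) (W := W) (N := N) (S := Finset.univ)
    (D := fun C => b C x x' - b C y x' - b C x y' + b C y y') ?_ (by omega) ?_ ?_ _ ?_ ?_ ?_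
  · intro C k hk B
    rw [hK] at hk
    simp only [hbD C k hk.1 hk.2 B, Finset.sum_add_distrib, Finset.sum_sub_distrib]
  · have := Finset.le_card_sdiff [x, y, x', y'].toFinset (Finset.univ : Finset V)
    have h4 := List.toFinset_card_le [x, y, x', y']
    simp only [List.length_cons, List.length_nil] at h4
    rw [Finset.card_univ] at this
    change _ ≤ #W at this
    omega
  · intro C hCW hCc hCd
    refine boxSum_four_term_of_disjoint ha (by omega) h hij hK hcV hnd (fun k hk v hv => ?_) hCc hCd
    have := hCW k hk hv
    simp only [W, Finset.mem_sdiff, List.mem_toFinset] at this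
    exact this.2
  · intro k hk
    rw [hK] at hk
    simpa [W] using hw k hk.1 hk.2
  · simp
  · intro k hk l hl hkl
    have hk' := (hK k).1 hk
    have hl' := (hK l).1 hl
    simpa [Function.onFun] using fun e => hkl (hinj k l hk'.1 hk'.2 hl'.1 hl'.2 e)

end FourTerm

section Select

variable {ι V : Type*} [DecidableEq ι]

/-- The point whose coordinates in `S` are those of the first half of `z`, the others being those
of the second half. -/
def select (z : ι ⊕ ι → V) (S : Finset ι) (i : ι) : V :=
  z (if i ∈ S then Sum.inl i else Sum.inr i)

theorem four_term_select [Fintype ι] [Fintype V] [DecidableEq V] {a : (ι → V) → ℂ}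
    (ha : ∀ (σ : Equiv.Perm ι) x, a (fun i => x (σ i)) = a x) {N : ℕ} (hN : 3 ≤ N)
    (hV : Fintype.card V = Fintype.card ι * N)
    (h : ∀ A : ι → Finset V, (∀ i j, i ≠ j → Disjoint (A i) (A j)) → (∀ i, #(A i) = N) →
      boxSum a A = 0) {z : ι ⊕ ι → V} (hz : Function.Injective z) {i j : ι} (hij : i ≠ j)
    {S : Finset ι} (hi : i ∉ S) (hj : j ∉ S) :
    a (select z (insert i (insert j S))) - a (select z (insert j S)) -
      a (select z (insert i S)) + a (select z S) = 0 := by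
  have key := four_term_of_boxSum_eq_zero ha hN hV h hij (select z S)
    (x := z (Sum.inl i)) (y := z (Sum.inr i)) (x' := z (Sum.inl j)) (y' := z (Sum.inr j))
    (by simp [hz.eq_iff, hij]) ?_ ?_
  · convert key using 4
    all_goals
      congr 1
      funext l
      rcases eq_or_ne l j with rfl | hlj
      · simp [select, hij.symm, *]
      rcases eq_or_ne l i with rfl | hli
      · simp [select, *]
      · simp [select, *]
  · intro k hki hkj
    simp only [select]
    split_ifs <;> simp [hz.eq_iff, hki, hkj]
  · intro k l _ _ _ _ hkl
    simp only [select, hz.eq_iff] at hkl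
    split_ifs at hkl <;> simpa using hkl

theorem sub_empty_eq_sum_of_four_term {h : Finset ι → ℂ}
    (h4 : ∀ i j S, i ≠ j → i ∉ S → j ∉ S →
      h (insert i (insert j S)) - h (insert j S) - h (insert i S) + h S = 0) (S : Finset ι) :
    h S - h ∅ = ∑ i ∈ S, (h {i} - h ∅) := by
  have step : ∀ (S : Finset ι) k, k ∉ S → h (insert k S) - h S = h {k} - h ∅ := by
    intro S
    induction S using Finset.induction_on with
    | empty => intro k _; simp
    | insert j S hj ih =>
      intro k hk
      rw [Finset.mem_insert, not_or] at hk
      rw [← ih k hk.2]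
      linear_combination h4 k j S hk.1 hk.2 hj
  induction S using Finset.induction_on with
  | empty => simp
  | insert k S hk ih =>
    rw [Finset.sum_insert hk, ← ih, ← step S k hk]
    ring

end Select

section Cells

/-- The index of the cell of the uniform grid of step `1 / n` which contains `t ∈ [0, 1]`. -/
noncomputable def cellIndex (n : ℕ) [NeZero n] (t : ℝ) : Fin n :=
  ⟨min ⌊n * t⌋₊ (n - 1), by have := NeZero.pos n; omega⟩

/-- The cells of the uniform grid of step `1 / n` on `[0, 1]`. -/
def cell (n : ℕ) [NeZero n] (k : Fin n) : Set ℝ := Set.Icc 0 1 ∩ cellIndex n ⁻¹' {k}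

/-- The integral of `f` over the product of cells indexed by `x`. -/
noncomputable def cellIntegral {ι : Type*} [Fintype ι] (f : (ι → ℝ) → ℂ) (n : ℕ) [NeZero n]
    (x : ι → Fin n) : ℂ :=
  ∫ t in Set.univ.pi fun i => cell n (x i), f t

variable {n : ℕ} [NeZero n]

theorem measurable_cellIndex : Measurable (cellIndex n) := by
  have : Measurable fun t : ℝ => min ⌊n * t⌋₊ (n - 1) := by fun_prop
  refine measurable_to_countable' fun k => ?_
  convert this (measurableSet_singleton (k : ℕ)) using 1
  ext t
  simp [cellIndex, Fin.ext_iff]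

theorem measurableSet_cell (k : Fin n) : MeasurableSet (cell n k) :=
  measurableSet_Icc.inter (measurable_cellIndex (measurableSet_singleton k))

theorem disjoint_cell {k l : Fin n} (h : k ≠ l) : Disjoint (cell n k) (cell n l) :=
  Set.disjoint_left.2 fun _ hk hl => h (hk.2.symm.trans hl.2)

theorem cell_subset_closedBall (k : Fin n) :
    cell n k ⊆ Metric.closedBall ((k + 1 / 2) / n : ℝ) (1 / (2 * n)) := by
  have hn : (0 : ℝ) < n := by exact_mod_cast NeZero.pos n
  rintro t ⟨⟨h0, h1⟩, hk⟩
  have hk' : min ⌊n * t⌋₊ (n - 1) = (k : ℕ) := congrArg Fin.val hk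
  have hnt : (0 : ℝ) ≤ n * t := by positivity
  have hlo : (k : ℝ) ≤ n * t := (Nat.le_floor_iff hnt).1 (hk' ▸ min_le_left _ _)
  have hhi : n * t ≤ k + 1 := by
    rcases le_total ⌊n * t⌋₊ (n - 1) with h | h
    · rw [min_eq_left h] at hk'
      have := (Nat.lt_floor_add_one (n * t)).le
      rwa [hk'] at this
    · rw [min_eq_right h] at hk'
      have : (k : ℝ) + 1 = n := by
        have := NeZero.pos n
        exact_mod_cast (by omega : (k : ℕ) + 1 = n)
      rw [this]
      nlinarith
  rw [Real.closedBall_eq_Icc]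
  constructor
  · rw [show ((k : ℝ) + 1 / 2) / n - 1 / (2 * n) = k / n by field_simp; ring, div_le_iff₀ hn]
    linarith
  · rw [show ((k : ℝ) + 1 / 2) / n + 1 / (2 * n) = (k + 1) / n by field_simp; ring, le_div_iff₀ hn]
    linarith

theorem Ioo_subset_cell (k : Fin n) : Set.Ioo ((k : ℝ) / n) ((k + 1) / n) ⊆ cell n k := by
  have hn : (0 : ℝ) < n := by exact_mod_cast NeZero.pos n
  have hkn : (k : ℝ) + 1 ≤ n := by exact_mod_cast k.2
  rintro t ⟨hlo, hhi⟩
  have ht0 : 0 ≤ t := le_trans (by positivity) hlo.le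
  rw [div_lt_iff₀ hn] at hlo
  rw [lt_div_iff₀ hn] at hhi
  refine ⟨⟨ht0, by nlinarith⟩, Fin.ext ?_⟩
  have : ⌊n * t⌋₊ = (k : ℕ) := by
    rw [Nat.floor_eq_iff (by positivity)]
    constructor <;> linarith
  change min ⌊n * t⌋₊ (n - 1) = (k : ℕ)
  rw [this]
  have := k.2
  omega

theorem cell_ae_eq_closedBall (k : Fin n) :
    cell n k =ᵐ[volume] Metric.closedBall ((k + 1 / 2) / n : ℝ) (1 / (2 * n)) := by
  have hn : (n : ℝ) ≠ 0 := by exact_mod_cast NeZero.ne n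
  refine (cell_subset_closedBall k).eventuallyLE.antisymm ?_
  rw [Real.closedBall_eq_Icc,
    show ((k : ℝ) + 1 / 2) / n - 1 / (2 * n) = k / n by field_simp; ring,
    show ((k : ℝ) + 1 / 2) / n + 1 / (2 * n) = (k + 1) / n by field_simp; ring]
  exact Ioo_ae_eq_Icc.symm.le.trans (Ioo_subset_cell k).eventuallyLE

theorem volume_cell (k : Fin n) : volume (cell n k) = ENNReal.ofReal (1 / n) := by
  rw [measure_congr (cell_ae_eq_closedBall k), Real.volume_closedBall]
  congr 1
  field_simp

theorem pi_cell_subset {ι : Type*} (x : ι → Fin n) :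
    (Set.univ.pi fun i => cell n (x i)) ⊆ Set.univ.pi fun _ => Set.Icc 0 1 :=
  Set.pi_mono fun _ _ => Set.inter_subset_left

variable {ι : Type*} [Fintype ι]

theorem boxSum_cellIntegral [DecidableEq ι] {f : (ι → ℝ) → ℂ}
    (hf : IntegrableOn f (Set.univ.pi fun _ => Set.Icc 0 1)) (A : ι → Finset (Fin n)) :
    boxSum (cellIntegral f n) A = ∫ t in Set.univ.pi fun i => ⋃ k ∈ A i, cell n k, f t := by
  have hU : (Set.univ.pi fun i => ⋃ k ∈ A i, cell n k) =
      ⋃ x ∈ Fintype.piFinset A, Set.univ.pi fun i => cell n (x i) := by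
    ext t
    simp only [Set.mem_univ_pi, Set.mem_iUnion, Fintype.mem_piFinset, exists_prop]
    constructor
    · intro h
      choose x hx using h
      exact ⟨x, fun i => (hx i).1, fun i => (hx i).2⟩
    · rintro ⟨x, hx, ht⟩ i
      exact ⟨x i, hx i, ht i⟩
  rw [hU, integral_biUnion_finset]
  · rfl
  · exact fun x _ => MeasurableSet.univ_pi fun i => measurableSet_cell _
  · intro x _ y _ hxy
    obtain ⟨i, hi⟩ := Function.ne_iff.1 hxy
    exact Set.disjoint_left.2 fun t htx hty =>
      Set.disjoint_left.1 (disjoint_cell hi) (htx i trivial) (hty i trivial)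
  · exact fun x _ => hf.mono_set (pi_cell_subset x)

theorem cellIntegral_comp_perm {f : (ι → ℝ) → ℂ}
    (hsym : ∀ (σ : Equiv.Perm ι) x, f (fun i => x (σ i)) = f x) (σ : Equiv.Perm ι)
    (x : ι → Fin n) : cellIntegral f n (fun i => x (σ i)) = cellIntegral f n x := by
  have hmp := volume_measurePreserving_piCongrLeft (fun _ : ι => ℝ) σ
  unfold cellIntegral
  symm
  rw [← hmp.setIntegral_preimage_emb (MeasurableEquiv.measurableEmbedding _)]
  have happ : ∀ (t : ι → ℝ) i, MeasurableEquiv.piCongrLeft (fun _ : ι => ℝ) σ t (σ i) = t i :=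
    fun t i => by simp [MeasurableEquiv.coe_piCongrLeft, Equiv.piCongrLeft_apply_apply]
  congr 1
  · congr 1
    ext t
    simp only [Set.mem_univ_pi, Set.mem_preimage]
    constructor
    · intro h i
      rw [← happ t]
      exact h (σ i)
    · intro h i
      obtain ⟨j, rfl⟩ := σ.surjective i
      rw [happ t]
      exact h j
  · funext t
    rw [← hsym σ (MeasurableEquiv.piCongrLeft _ σ t)]
    simp only [happ]

end Cells

section Lebesgue

variable {ι : Type*} [Fintype ι]

theorem ae_tendsto_cellIntegral {f : (ι → ℝ) → ℂ}
    (hf : IntegrableOn f (Set.univ.pi fun _ => Set.Icc 0 1)) {M : ℕ → ℕ} [∀ N, NeZero (M N)]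
    (hM : Tendsto M atTop atTop) :
    ∀ᵐ x : ι → ℝ, (∀ i, x i ∈ Set.Icc (0 : ℝ) 1) →
      Tendsto (fun N => (((1 / M N : ℝ) ^ Fintype.card ι)⁻¹ : ℝ) •
        cellIntegral f (M N) (fun i => cellIndex (M N) (x i))) atTop (nhds (f x)) := by
  have hcube : MeasurableSet (Set.univ.pi fun _ : ι => Set.Icc (0 : ℝ) 1) :=
    MeasurableSet.univ_pi fun _ => measurableSet_Icc
  have hF := hf.integrable_indicator hcube
  filter_upwards [IsUnifLocDoublingMeasure.ae_tendsto_average volume hF.locallyIntegrable 1]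
    with x hx hx01
  have hδ : Tendsto (fun N => (1 / (2 * M N) : ℝ)) atTop (nhdsWithin 0 (Set.Ioi 0)) := by
    refine tendsto_nhdsWithin_iff.2 ⟨?_, Eventually.of_forall fun N => ?_⟩
    · have : Tendsto (fun N => (2 * M N : ℝ)) atTop atTop :=
        (tendsto_natCast_atTop_atTop.comp hM).const_mul_atTop two_pos
      simpa only [one_div] using! this.inv_tendsto_atTop
    · have : (0 : ℝ) < M N := by exact_mod_cast NeZero.pos (M N)
      simp only [Set.mem_Ioi]
      positivity
  have key := hx (fun N i => ((cellIndex (M N) (x i) + 1 / 2) / M N : ℝ)) _ hδ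
    (Eventually.of_forall fun N => ?_)
  · have hxm : x ∈ Set.univ.pi fun _ : ι => Set.Icc (0 : ℝ) 1 := fun i _ => hx01 i
    rw [Set.indicator_of_mem hxm] at key
    refine key.congr fun N => ?_
    have hM0 : (0 : ℝ) < M N := by exact_mod_cast NeZero.pos (M N)
    have hr : (0 : ℝ) ≤ 1 / (2 * M N) := by positivity
    rw [setAverage_eq, Measure.real, Real.volume_pi_closedBall _ hr,
      ENNReal.toReal_ofReal (by positivity)]
    congr 1
    · field_simp
    · rw [closedBall_pi _ hr]
      have hae : (Set.univ.pi fun i => cell (M N) (cellIndex (M N) (x i))) =ᵐ[volume]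
          Set.univ.pi fun i => Metric.closedBall
            ((cellIndex (M N) (x i) + 1 / 2) / M N : ℝ) (1 / (2 * M N)) :=
        Measure.ae_eq_set_pi fun i _ => cell_ae_eq_closedBall _
      rw [← setIntegral_congr_set hae]
      refine setIntegral_congr_fun (MeasurableSet.univ_pi fun i => measurableSet_cell _)
        fun t ht => ?_
      exact Set.indicator_of_mem (pi_cell_subset _ ht) _
  · rw [one_mul, closedBall_pi _ (by positivity)]
    exact fun i _ => cell_subset_closedBall _ ⟨hx01 i, rfl⟩

theorem eventually_cellIndex_ne {M : ℕ → ℕ} [∀ N, NeZero (M N)] (hM : Tendsto M atTop atTop)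
    {s t : ℝ} (hs : s ∈ Set.Icc (0 : ℝ) 1) (ht : t ∈ Set.Icc (0 : ℝ) 1) (hst : s ≠ t) :
    ∀ᶠ N in atTop, cellIndex (M N) s ≠ cellIndex (M N) t := by
  have hd : 0 < dist s t := dist_pos.2 hst
  have h1 : Tendsto (fun N => ((M N : ℝ))⁻¹) atTop (nhds 0) :=
    (tendsto_natCast_atTop_atTop.comp hM).inv_tendsto_atTop
  filter_upwards [h1.eventually_lt_const hd] with N hN heq
  have e1 := cell_subset_closedBall (cellIndex (M N) s) ⟨hs, rfl⟩
  have e2 := cell_subset_closedBall (cellIndex (M N) s) ⟨ht, heq.symm⟩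
  have hM0 : (0 : ℝ) < M N := by exact_mod_cast NeZero.pos (M N)
  have e3 := dist_triangle_right s t ((cellIndex (M N) s + 1 / 2) / M N : ℝ)
  rw [Metric.mem_closedBall] at e1 e2
  have : (1 / (2 * M N) + 1 / (2 * M N) : ℝ) = (M N : ℝ)⁻¹ := by field_simp; norm_num
  linarith

end Lebesgue

section Products

variable {ι κ : Type*} [Fintype ι] [Fintype κ]

theorem measurePreserving_comp_injective (μ : Measure ℝ) [IsProbabilityMeasure μ] {e : ι → κ}
    (he : Function.Injective e) :
    MeasurePreserving (fun (z : κ → ℝ) i => z (e i)) (Measure.pi fun _ => μ)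
      (Measure.pi fun _ => μ) := by
  have hm : Measurable fun (z : κ → ℝ) i => z (e i) := by fun_prop
  refine ⟨hm, (Measure.pi_eq fun s hs => ?_).symm⟩
  have hpre : (fun (z : κ → ℝ) i => z (e i)) ⁻¹' Set.univ.pi s =
      Set.univ.pi (Function.extend e s fun _ => Set.univ) := by
    ext z
    simp only [Set.mem_preimage, Set.mem_univ_pi]
    constructor
    · intro h k
      by_cases hk : ∃ i, e i = k
      · obtain ⟨i, rfl⟩ := hk
        simpa [he.extend_apply] using h i
      · simp [Function.extend_apply' _ _ _ hk]
    · intro h i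
      simpa [he.extend_apply] using h (e i)
  rw [Measure.map_apply hm (MeasurableSet.univ_pi hs), hpre, Measure.pi_pi]
  refine (Fintype.prod_of_injective e he _ _ (fun k hk => ?_) fun i => ?_).symm
  · rw [Function.extend_apply' _ _ _ (by simpa using hk), measure_univ]
  · rw [he.extend_apply]

theorem ae_injective : ∀ᵐ z : κ → ℝ, Function.Injective z := by
  have h : ∀ k l : κ, k ≠ l → ∀ᵐ z : κ → ℝ, z k ≠ z l := by
    classical
    intro k l hkl
    let φ : (κ → ℝ) →ₗ[ℝ] ℝ := (LinearMap.proj k : (κ → ℝ) →ₗ[ℝ] ℝ) - LinearMap.proj l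
    have hφ : LinearMap.ker φ ≠ ⊤ := by
      intro htop
      have : Pi.single k (1 : ℝ) ∈ LinearMap.ker φ := htop ▸ Submodule.mem_top
      simp [φ, LinearMap.mem_ker, hkl.symm] at this
    refine measure_mono_null (fun z hz => ?_) (Measure.addHaar_submodule volume _ hφ)
    have : z k = z l := by simpa using hz
    simp [φ, LinearMap.mem_ker, this]
  filter_upwards [ae_all_iff.2 fun k => ae_all_iff.2 fun l => ae_all_iff.2 (h k l)] with z hz
  intro k l hkl
  by_contra hne
  exact hz k l hne hkl

theorem pi_restrict_Icc : (Measure.pi fun _ : ι => volume.restrict (Set.Icc (0 : ℝ) 1)) =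
    volume.restrict (Set.univ.pi fun _ : ι => Set.Icc (0 : ℝ) 1) := by
  rw [volume_pi, Measure.restrict_pi_pi]

instance isProbabilityMeasure_restrict_Icc :
    IsProbabilityMeasure (volume.restrict (Set.Icc (0 : ℝ) 1)) :=
  ⟨by simp⟩

end Products

section Vanishing

theorem select_injective {ι : Type*} [DecidableEq ι] (S : Finset ι) :
    Function.Injective fun i : ι => if i ∈ S then (Sum.inl i : ι ⊕ ι) else Sum.inr i := by
  intro k l hkl
  dsimp only at hkl
  split_ifs at hkl <;> simpa using hkl

variable {ι : Type*} [Fintype ι] [DecidableEq ι] {f : (ι → ℝ) → ℂ}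

theorem boxSum_cellIntegral_eq_zero
    (hint : IntegrableOn f (Set.univ.pi fun _ => Set.Icc 0 1))
    (h0 : ∀ A : ι → Set ℝ, (∀ i, MeasurableSet (A i)) →
        Pairwise (fun i j => Disjoint (A i) (A j)) → (⋃ i, A i) = Set.Icc 0 1 →
        (∀ i, volume (A i) = ENNReal.ofReal (1 / (Fintype.card ι : ℝ))) →
        ∫ x in Set.univ.pi A, f x = 0)
    {n N : ℕ} [NeZero n] (hn : n = Fintype.card ι * N) (A : ι → Finset (Fin n))
    (hA : ∀ i j, i ≠ j → Disjoint (A i) (A j)) (hAc : ∀ i, #(A i) = N) :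
    boxSum (cellIntegral f n) A = 0 := by
  rw [boxSum_cellIntegral hint]
  apply h0
  · exact fun i => Finset.measurableSet_biUnion _ fun k _ => measurableSet_cell k
  · intro i j hij
    simp only [Set.disjoint_iUnion_left, Set.disjoint_iUnion_right]
    exact fun k hk l hl => disjoint_cell (Finset.disjoint_iff_ne.1 (hA i j hij) l hl k hk)
  · have huniv : Finset.univ.biUnion A = Finset.univ := by
      apply Finset.eq_univ_of_card
      rw [Finset.card_biUnion fun i _ j _ => hA i j, Finset.sum_congr rfl fun i _ => hAc i,
        Finset.sum_const, Finset.card_univ, smul_eq_mul, Fintype.card_fin, hn]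
    refine Set.Subset.antisymm ?_ fun t ht => ?_
    · exact Set.iUnion_subset fun i => Set.iUnion₂_subset fun k _ => Set.inter_subset_left
    · obtain ⟨i, -, hi⟩ := Finset.mem_biUnion.1 (huniv ▸ Finset.mem_univ (cellIndex n t))
      exact Set.mem_iUnion.2 ⟨i, Set.mem_iUnion₂.2 ⟨_, hi, ht, rfl⟩⟩
  · intro i
    have hN : (N : ℝ) ≠ 0 := fun h => NeZero.ne n (by rw [hn, Nat.cast_eq_zero.1 h, mul_zero])
    rw [measure_biUnion_finset (fun k _ l _ => disjoint_cell) fun k _ => measurableSet_cell k,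
      Finset.sum_congr rfl fun k _ => volume_cell k, Finset.sum_const, hAc, nsmul_eq_mul,
      ← ENNReal.ofReal_natCast, ← ENNReal.ofReal_mul (by positivity), hn]
    congr 1
    push_cast
    field_simp

theorem ae_sub_eq_sum_select [Nonempty ι]
    (hsym : ∀ (σ : Equiv.Perm ι) (x : ι → ℝ), f (fun i => x (σ i)) = f x)
    (hint : IntegrableOn f (Set.univ.pi fun _ => Set.Icc 0 1))
    (h0 : ∀ A : ι → Set ℝ, (∀ i, MeasurableSet (A i)) →
        Pairwise (fun i j => Disjoint (A i) (A j)) → (⋃ i, A i) = Set.Icc 0 1 →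
        (∀ i, volume (A i) = ENNReal.ofReal (1 / (Fintype.card ι : ℝ))) →
        ∫ x in Set.univ.pi A, f x = 0) :
    ∀ᵐ z ∂(Measure.pi fun _ : ι ⊕ ι => volume.restrict (Set.Icc (0 : ℝ) 1)),
      f (select z Finset.univ) - f (select z ∅) = ∑ i, (f (select z {i}) - f (select z ∅)) := by
  let M : ℕ → ℕ := fun N => Fintype.card ι * (N + 3)
  have : ∀ N, NeZero (M N) := fun N =>
    ⟨Nat.mul_ne_zero Fintype.card_ne_zero (Nat.succ_ne_zero _)⟩
  have hM : Tendsto M atTop atTop :=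
    tendsto_atTop_mono (fun N => (Nat.le_add_right N 3).trans
      (Nat.le_mul_of_pos_left _ Fintype.card_pos)) tendsto_id
  have hlim := (ae_restrict_of_ae (s := Set.univ.pi fun _ : ι => Set.Icc (0 : ℝ) 1)
    (ae_tendsto_cellIntegral hint hM))
  rw [← pi_restrict_Icc] at hlim
  have hinj := ae_restrict_of_ae (s := Set.univ.pi fun _ : ι ⊕ ι => Set.Icc (0 : ℝ) 1)
    (ae_injective (κ := ι ⊕ ι))
  have hmem := ae_restrict_mem (μ := (volume : Measure (ι ⊕ ι → ℝ)))
    (MeasurableSet.univ_pi fun _ : ι ⊕ ι => measurableSet_Icc (a := (0 : ℝ)) (b := 1))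
  rw [← pi_restrict_Icc] at hinj hmem
  filter_upwards [hinj, hmem, ae_all_iff.2 fun S : Finset ι =>
    (measurePreserving_comp_injective (volume.restrict (Set.Icc (0 : ℝ) 1))
      (select_injective S)).quasiMeasurePreserving.ae hlim] with z hz hz01 hzlim
  refine sub_empty_eq_sum_of_four_term (h := fun S => f (select z S)) (fun i j S hij hi hj => ?_) _
  have hl := fun T => hzlim T fun i => hz01 _ trivial
  refine tendsto_nhds_unique ((((hl (insert i (insert j S))).sub (hl (insert j S))).sub
    (hl (insert i S))).add (hl S)) (tendsto_const_nhds.congr' ?_)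
  have hne : ∀ᶠ N in atTop, Function.Injective fun k => cellIndex (M N) (z k) := by
    have : ∀ k l, k ≠ l → ∀ᶠ N in atTop, cellIndex (M N) (z k) ≠ cellIndex (M N) (z l) :=
      fun k l hkl => eventually_cellIndex_ne hM (hz01 k trivial) (hz01 l trivial) (hz.ne hkl)
    filter_upwards [eventually_all.2 fun k => eventually_all.2 fun l =>
      eventually_imp_distrib_left.2 (this k l)] with N hN k l hkl
    by_contra hkl'
    exact hN k l hkl' hkl
  filter_upwards [hne] with N hN
  have key := four_term_select (a := cellIntegral f (M N)) (N := N + 3)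
    (cellIntegral_comp_perm hsym) (by omega) (by simp [M])
    (boxSum_cellIntegral_eq_zero hint h0 rfl) hN hij hi hj
  rw [← smul_sub, ← smul_sub, ← smul_add]
  exact (smul_eq_zero_of_right _ key).symm

end Vanishing

section Decomposition

variable {ι : Type*} [Fintype ι] [DecidableEq ι]

theorem measurePreserving_select (μ : Measure ℝ) [IsProbabilityMeasure μ] (S : Finset ι) :
    MeasurePreserving (fun z : ι ⊕ ι → ℝ => select z S) (Measure.pi fun _ => μ)
      (Measure.pi fun _ => μ) :=
  measurePreserving_comp_injective μ (select_injective S)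

theorem exists_ae_eq_sum_eval [Nonempty ι] {μ : Measure ℝ} [IsProbabilityMeasure μ]
    {f : (ι → ℝ) → ℂ} (hf : Integrable f (Measure.pi fun _ => μ))
    (h : ∀ᵐ z ∂(Measure.pi fun _ : ι ⊕ ι => μ),
      f (select z Finset.univ) - f (select z ∅) = ∑ i, (f (select z {i}) - f (select z ∅))) :
    ∃ g : ι → ℝ → ℂ, (∀ i, Integrable (g i) μ) ∧
      f =ᵐ[Measure.pi fun _ => μ] fun x => ∑ i, g i (x i) := by
  let f' := hf.1.mk f
  have hff' : f =ᵐ[Measure.pi fun _ => μ] f' := hf.1.ae_eq_mk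
  have hf'm : StronglyMeasurable f' := hf.1.stronglyMeasurable_mk
  have hf' : Integrable f' (Measure.pi fun _ => μ) := hf.congr hff'
  let φ : (ι → ℝ) × (ι → ℝ) → ι ⊕ ι → ℝ := fun q => Sum.elim q.2 q.1
  have hφ : MeasurePreserving φ ((Measure.pi fun _ => μ).prod (Measure.pi fun _ => μ))
      (Measure.pi fun _ => μ) := by
    convert (measurePreserving_sumPiEquivProdPi_symm (fun _ : ι ⊕ ι => μ)).comp
      Measure.measurePreserving_swap using 1
    ext q (i | i) <;> rfl
  have huniv : ∀ q, select (φ q) Finset.univ = q.2 := fun q => by ext; simp [select, φ]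
  have hempty : ∀ q, select (φ q) ∅ = q.1 := fun q => by ext; simp [select, φ]
  have hsingle : ∀ q i, select (φ q) {i} = Function.update q.1 i (q.2 i) := fun q i => by
    ext j
    by_cases hj : j = i
    · subst hj; simp [select, φ]
    · simp [select, φ, hj]
  have h' : ∀ᵐ z ∂(Measure.pi fun _ : ι ⊕ ι => μ),
      f' (select z Finset.univ) - f' (select z ∅) =
        ∑ i, (f' (select z {i}) - f' (select z ∅)) := by
    filter_upwards [h, ae_all_iff.2 fun S : Finset ι =>
      (measurePreserving_select μ S).quasiMeasurePreserving.ae hff'] with z hz hS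
    simpa only [hS] using hz
  have hae := Measure.ae_ae_of_ae_prod (hφ.quasiMeasurePreserving.ae h')
  have hi : ∀ i, ∀ᵐ p ∂(Measure.pi fun _ : ι => μ),
      Integrable (fun x : ι → ℝ => f' (Function.update p i (x i))) (Measure.pi fun _ => μ) := by
    intro i
    have := (((measurePreserving_select μ {i}).comp hφ).integrable_comp_of_integrable
      hf').prod_right_ae
    simpa only [Function.comp_def, hsingle] using this
  obtain ⟨p, hp, hpi⟩ := (hae.and (ae_all_iff.2 hi)).exists
  refine ⟨fun i y => f' (Function.update p i y) - f' p + (Fintype.card ι : ℂ)⁻¹ * f' p,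
    fun i => ?_, ?_⟩
  · refine Integrable.add (Integrable.sub ?_ (integrable_const _)) (integrable_const _)
    refine ((measurePreserving_eval (fun _ : ι => μ) i).integrable_comp ?_).1 (hpi i)
    exact (hf'm.comp_measurable (measurable_update p)).aestronglyMeasurable
  · filter_upwards [hff', hp] with x hx hpx
    simp only [huniv, hempty, hsingle] at hpx
    have hc : (Fintype.card ι : ℂ) ≠ 0 := Nat.cast_ne_zero.2 Fintype.card_ne_zero
    rw [hx, Finset.sum_add_distrib, ← hpx, Finset.sum_const, Finset.card_univ, nsmul_eq_mul,
      mul_inv_cancel_left₀ hc, sub_add_cancel]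

theorem ae_eq_sum_average {m : ℕ} [NeZero m] {μ : Measure ℝ} [IsProbabilityMeasure μ]
    {f : (Fin m → ℝ) → ℂ} (hsym : ∀ (σ : Equiv.Perm (Fin m)) x, f (fun i => x (σ i)) = f x)
    {g : Fin m → ℝ → ℂ} (h : f =ᵐ[Measure.pi fun _ => μ] fun x => ∑ i, g i (x i)) :
    f =ᵐ[Measure.pi fun _ => μ] fun x => ∑ j, (m : ℂ)⁻¹ * ∑ i, g i (x j) := by
  filter_upwards [ae_all_iff.2 fun s : Fin m => (measurePreserving_comp_injective μ
    (Equiv.addRight s).injective).quasiMeasurePreserving.ae h] with x hx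
  have hm : (m : ℂ) ≠ 0 := Nat.cast_ne_zero.2 (NeZero.ne m)
  rw [← Finset.mul_sum, eq_inv_mul_iff_mul_eq₀ hm, Finset.sum_comm]
  calc (m : ℂ) * f x = ∑ _s : Fin m, f x := by simp
    _ = ∑ s, ∑ i, g i (x (i + s)) :=
      Finset.sum_congr rfl fun s _ => (hsym (Equiv.addRight s) x).symm.trans (hx s)
    _ = ∑ i, ∑ s, g i (x (i + s)) := Finset.sum_comm
    _ = ∑ i, ∑ j, g i (x j) :=
      Finset.sum_congr rfl fun i _ => Equiv.sum_comp (Equiv.addLeft i) fun j => g i (x j)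

theorem integral_pi_sum_eval {ν : ι → Measure ℝ} [∀ i, IsFiniteMeasure (ν i)] {c : ENNReal}
    (hν : ∀ i, ν i Set.univ = c) {g : ℝ → ℂ} (hg : ∀ i, Integrable g (ν i)) :
    ∫ x, ∑ i, g (x i) ∂(Measure.pi ν) =
      (c ^ (Fintype.card ι - 1)).toReal • ∑ i, ∫ t, g t ∂(ν i) := by
  have hmap : ∀ i, (Measure.pi ν).map (Function.eval i) = c ^ (Fintype.card ι - 1) • ν i := by
    intro i
    rw [Measure.pi_map_eval, Finset.prod_congr rfl fun j _ => hν j, Finset.prod_const,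
      Finset.card_erase_of_mem (Finset.mem_univ i), Finset.card_univ]
  rw [integral_finsetSum _ fun i _ => integrable_comp_eval (hg i), Finset.smul_sum]
  refine Finset.sum_congr rfl fun i _ => ?_
  rw [← integral_smul_measure, ← hmap, integral_map (measurable_pi_apply i).aemeasurable]
  change AEStronglyMeasurable g ((Measure.pi ν).map (Function.eval i))
  rw [hmap]
  exact (hg i).1.smul_measure _

end Decomposition

/-- **Lemma (Lmain).** If `f : [0,1]^m → ℂ` is symmetric, integrable, and
`∫_{A₁×⋯×A_m} f = 0` for every partition of `[0,1]` into `m` disjoint measurable sets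
of measure `1/m`, then `f(x₁,…,x_m) = g(x₁) + ⋯ + g(x_m)` a.e. for some integrable
`g` with `∫ g = 0`. -/
theorem stmt8 (m : ℕ) (hm : 1 ≤ m) (f : (Fin m → ℝ) → ℂ)
    (hsym : ∀ (σ : Equiv.Perm (Fin m)) (x : Fin m → ℝ), f (fun i => x (σ i)) = f x)
    (hint : IntegrableOn f (Set.univ.pi fun _ => Set.Icc 0 1))
    (h0 : ∀ A : Fin m → Set ℝ, (∀ i, MeasurableSet (A i)) →
        Pairwise (fun i j => Disjoint (A i) (A j)) →
        (⋃ i, A i) = Set.Icc 0 1 →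
        (∀ i, volume (A i) = ENNReal.ofReal (1 / (m : ℝ))) →
        ∫ x in Set.univ.pi A, f x = 0) :
    ∃ g : ℝ → ℂ, IntegrableOn g (Set.Icc 0 1) ∧
      (∫ x in Set.Icc (0 : ℝ) 1, g x = 0) ∧
      f =ᵐ[volume.restrict (Set.univ.pi fun _ : Fin m => Set.Icc (0 : ℝ) 1)]
        fun x => ∑ i, g (x i) := by
  have : NeZero m := ⟨by omega⟩
  have hint' : Integrable f (Measure.pi fun _ => volume.restrict (Set.Icc (0 : ℝ) 1)) := by
    rw [pi_restrict_Icc]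
    exact hint
  obtain ⟨g', hg', hfg'⟩ := exists_ae_eq_sum_eval hint'
    (ae_sub_eq_sum_select hsym hint (by simpa using h0))
  obtain ⟨g, hg, hfg⟩ : ∃ g : ℝ → ℂ, Integrable g (volume.restrict (Set.Icc 0 1)) ∧
      f =ᵐ[Measure.pi fun _ => volume.restrict (Set.Icc (0 : ℝ) 1)] fun x => ∑ i, g (x i) :=
    ⟨_, (integrable_finsetSum _ fun i _ => hg' i).const_mul _, ae_eq_sum_average hsym hfg'⟩
  rw [pi_restrict_Icc] at hfg
  refine ⟨g, hg, ?_, hfg⟩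
  have hU : ⋃ k, cell m k = Set.Icc (0 : ℝ) 1 :=
    Set.Subset.antisymm (Set.iUnion_subset fun k => Set.inter_subset_left)
      fun t ht => Set.mem_iUnion.2 ⟨cellIndex m t, ht, rfl⟩
  have hcell := h0 (cell m) measurableSet_cell (fun _ _ => disjoint_cell) hU volume_cell
  have hgc : ∀ k, IntegrableOn g (cell m k) := fun k =>
    IntegrableOn.mono_set hg Set.inter_subset_left
  have hfin : ∀ k, IsFiniteMeasure (volume.restrict (cell m k)) := fun k =>
    ⟨by simp [volume_cell]⟩
  have hsub : Set.univ.pi (cell m) ⊆ Set.univ.pi fun _ => Set.Icc 0 1 := pi_cell_subset id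
  rw [integral_congr_ae (ae_restrict_of_ae_restrict_of_subset hsub hfg), volume_pi,
    Measure.restrict_pi_pi,
    integral_pi_sum_eval (fun k => by rw [Measure.restrict_apply_univ, volume_cell]) hgc,
    ← integral_iUnion_fintype measurableSet_cell (fun _ _ => disjoint_cell) hgc, hU] at hcell
  refine (smul_eq_zero.1 hcell).resolve_left ?_
  have hm0 : (0 : ℝ) < 1 / m := by positivity
  rw [ENNReal.toReal_pow, ENNReal.toReal_ofReal hm0.le]
  exact (pow_pos hm0 _).ne'
end

section
/- Let m ≥ 1 and let α_1,…,α_m ∈ (0,1) with Σ_{i=1}^m α_i ≤ 1. Suppose f is an integrable function on [0,1]^m such that ∫_{A_1×⋯×A_m} f = 0 for all sequences A_1,…,A_m of pairwise disjoint measurable subsets of [0,1] with λ(A_i) = α_i for i = 1,…,m. Suppose further that either (i) Σ_{i=1}^m α_i < 1, or (ii) Σ_{i=1}^m α_i = 1 but (α_1,…,α_m) ≠ (1/m,…,1/m) and f is symmetric. Then f = 0 almost everywhere. -/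
open Filter Finset Asymptotics MeasureTheory

/-- Lebesgue measure takes all intermediate values on the measurable subsets of `E`. -/
lemma exists_measurable_subset_measureReal_eq {E : Set ℝ} (hE : MeasurableSet E)
    (hE1 : E ⊆ Set.Icc 0 1) {t : ℝ} (ht0 : 0 ≤ t) (ht : t ≤ volume.real E) :
    ∃ S ⊆ E, MeasurableSet S ∧ volume.real S = t := by
  have hfin : volume E ≠ ⊤ := measure_ne_top_of_subset hE1 (by simp)
  have hfin' (x : ℝ) : volume (E ∩ Set.Iic x) ≠ ⊤ :=
    measure_ne_top_of_subset Set.inter_subset_left hfin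
  have hcont : Continuous fun x => volume.real (E ∩ Set.Iic x) := by
    refine (LipschitzWith.of_le_add fun x y => ?_).continuous
    have hxy : volume (Set.Icc y x) ≠ ⊤ := by simp
    calc volume.real (E ∩ Set.Iic x)
        ≤ volume.real ((E ∩ Set.Iic y) ∪ Set.Icc y x) := by
          refine measureReal_mono ?_ (measure_union_ne_top (hfin' y) hxy)
          rintro z ⟨hz, hzx⟩
          rcases le_total z y with h | h
          · exact Or.inl ⟨hz, h⟩
          · exact Or.inr ⟨h, hzx⟩
      _ ≤ volume.real (E ∩ Set.Iic y) + volume.real (Set.Icc y x) := measureReal_union_le _ _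
      _ ≤ volume.real (E ∩ Set.Iic y) + dist x y := by
          gcongr
          rw [Real.volume_real_Icc, Real.dist_eq]
          exact max_le (le_abs_self _) (abs_nonneg _)
  have h0 : volume.real (E ∩ Set.Iic (-1)) = 0 := by
    have : E ∩ Set.Iic (-1) = ∅ := by
      ext z
      simp only [Set.mem_inter_iff, Set.mem_Iic, Set.mem_empty_iff_false, iff_false, not_and, not_le]
      intro hz
      linarith [(hE1 hz).1]
    simp [this]
  have h1 : E ∩ Set.Iic 1 = E := Set.inter_eq_left.2 fun z hz => (hE1 hz).2
  obtain ⟨x, -, hx⟩ := intermediate_value_Icc (show (-1 : ℝ) ≤ 1 by norm_num) hcont.continuousOn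
    (show t ∈ Set.Icc _ _ from ⟨by rwa [h0], by rwa [h1]⟩)
  exact ⟨E ∩ Set.Iic x, Set.inter_subset_left, hE.inter measurableSet_Iic, hx⟩

/-- A finitely additive, absolutely continuous set function on the measurable subsets of `E`. -/
structure IsAddAbsCont (E : Set ℝ) (ν : Set ℝ → ℂ) : Prop where
  union : ∀ S T, MeasurableSet S → MeasurableSet T → S ⊆ E → T ⊆ E → Disjoint S T →
    ν (S ∪ T) = ν S + ν T
  small : ∀ ε > 0, ∃ δ > 0, ∀ S, MeasurableSet S → S ⊆ E → volume.real S < δ → ‖ν S‖ < ε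

namespace IsAddAbsCont

variable {E : Set ℝ} {ν ν' : Set ℝ → ℂ}

lemma mono {E' : Set ℝ} (h : IsAddAbsCont E ν) (hE : E' ⊆ E) : IsAddAbsCont E' ν where
  union S T hS hT hSE hTE := h.union S T hS hT (hSE.trans hE) (hTE.trans hE)
  small ε hε := by
    obtain ⟨δ, hδ, H⟩ := h.small ε hε
    exact ⟨δ, hδ, fun S hS hSE => H S hS (hSE.trans hE)⟩

lemma sub (h : IsAddAbsCont E ν) (h' : IsAddAbsCont E ν') :
    IsAddAbsCont E (fun S => ν S - ν' S) where
  union S T hS hT hSE hTE hd := by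
    simp only [h.union S T hS hT hSE hTE hd, h'.union S T hS hT hSE hTE hd]
    ring
  small ε hε := by
    obtain ⟨δ, hδ, H⟩ := h.small (ε / 2) (half_pos hε)
    obtain ⟨δ', hδ', H'⟩ := h'.small (ε / 2) (half_pos hε)
    refine ⟨min δ δ', lt_min hδ hδ', fun S hS hSE hlt => (norm_sub_le _ _).trans_lt ?_⟩
    linarith [H S hS hSE (hlt.trans_le (min_le_left _ _)),
      H' S hS hSE (hlt.trans_le (min_le_right _ _))]

lemma sdiff_add (h : IsAddAbsCont E ν) {S T : Set ℝ} (hS : MeasurableSet S) (hT : MeasurableSet T)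
    (hTE : T ⊆ E) (hST : S ⊆ T) : ν T = ν S + ν (T \ S) := by
  rw [← h.union S (T \ S) hS (hT.diff hS) (hST.trans hTE) (Set.sdiff_subset.trans hTE)
    Set.disjoint_sdiff_right, Set.union_sdiff_cancel hST]

end IsAddAbsCont

lemma measureReal_sdiff_of_subset_Icc {S T : Set ℝ} (hS : MeasurableSet S)
    (hT1 : T ⊆ Set.Icc 0 1) (hST : S ⊆ T) :
    volume.real (T \ S) = volume.real T - volume.real S :=
  measureReal_sdiff hST hS (measure_ne_top_of_subset hT1 (by simp))

lemma measureReal_union_of_subset_Icc {S T : Set ℝ} (hT : MeasurableSet T)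
    (hS1 : S ⊆ Set.Icc 0 1) (hT1 : T ⊆ Set.Icc 0 1) (hd : Disjoint S T) :
    volume.real (S ∪ T) = volume.real S + volume.real T :=
  measureReal_union hd hT (measure_ne_top_of_subset hS1 (by simp))
    (measure_ne_top_of_subset hT1 (by simp))

namespace IsAddAbsCont

variable {E : Set ℝ} {ν : Set ℝ → ℂ}

lemma eq_zero_of_measureReal_eq_zero (h : IsAddAbsCont E ν) {S : Set ℝ} (hS : MeasurableSet S)
    (hSE : S ⊆ E) (h0 : volume.real S = 0) : ν S = 0 := by
  by_contra hne
  obtain ⟨δ, hδ, H⟩ := h.small ‖ν S‖ (norm_pos_iff.2 hne)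
  exact lt_irrefl _ (H S hS hSE (h0 ▸ hδ))

lemma eq_nsmul_of_const (h : IsAddAbsCont E ν) (hE1 : E ⊆ Set.Icc 0 1) {t : ℝ} (ht : 0 ≤ t)
    {c : ℂ} (n : ℕ) {R : Set ℝ} (hR : MeasurableSet R) (hRE : R ⊆ E)
    (hn : volume.real R = n * t)
    (hc : ∀ T ⊆ R, MeasurableSet T → volume.real T = t → ν T = c) : ν R = n * c := by
  induction n generalizing R with
  | zero => simpa using h.eq_zero_of_measureReal_eq_zero hR hRE (by simpa using hn)
  | succ n ih =>
    push_cast at hn ⊢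
    obtain ⟨S, hSR, hS, hSt⟩ := exists_measurable_subset_measureReal_eq hR (hRE.trans hE1) ht
      (by rw [hn]; nlinarith [mul_nonneg n.cast_nonneg ht])
    have hd := measureReal_sdiff_of_subset_Icc hS (hRE.trans hE1) hSR
    rw [h.sdiff_add hS hR hRE hSR, hc S hSR hS hSt,
      ih (hR.diff hS) (Set.sdiff_subset.trans hRE) (by rw [hd, hn, hSt]; ring)
        fun T hT => hc T (hT.trans Set.sdiff_subset)]
    ring

/-- If `R` has value `0` and mass a multiple of that of `S ⊆ R`, and `S` can be exchanged for any
part of `R \ S` of the same mass, then `S` has value `0`. -/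
lemma eq_zero_of_exchange (h : IsAddAbsCont E ν) (hE1 : E ⊆ Set.Icc 0 1) {n : ℕ} {S R : Set ℝ}
    (hS : MeasurableSet S) (hR : MeasurableSet R) (hRE : R ⊆ E) (hSR : S ⊆ R)
    (hn : volume.real R = (n + 1) * volume.real S) (hR0 : ν R = 0)
    (hex : ∀ Q ⊆ R \ S, MeasurableSet Q → volume.real Q = volume.real S → ν Q = ν S) :
    ν S = 0 := by
  have key := h.eq_nsmul_of_const hE1 measureReal_nonneg n (hR.diff hS) (Set.sdiff_subset.trans hRE)
    (by rw [measureReal_sdiff_of_subset_Icc hS (hRE.trans hE1) hSR, hn]; ring) hex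
  rw [h.sdiff_add hS hR hRE hSR, key] at hR0
  have hn0 : ((n : ℂ) + 1) ≠ 0 := by exact_mod_cast n.succ_ne_zero
  exact (mul_eq_zero.1 (show ((n : ℂ) + 1) * ν S = 0 by linear_combination hR0)).resolve_left hn0

lemma eq_zero_of_small_pieces (h : IsAddAbsCont E ν) (hE1 : E ⊆ Set.Icc 0 1) {t : ℝ} (ht : 0 ≤ t)
    (h0 : ∀ T ⊆ E, MeasurableSet T → volume.real T = t → ν T = 0) (n : ℕ) {S : Set ℝ}
    (hS : MeasurableSet S) (hSE : S ⊆ E) (hn : volume.real S < (n + 1) * t) :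
    ∃ T ⊆ S, MeasurableSet T ∧ volume.real T < t ∧ ν S = ν T := by
  induction n generalizing S with
  | zero => exact ⟨S, subset_rfl, hS, by simpa using hn, rfl⟩
  | succ n ih =>
    rcases lt_or_ge (volume.real S) t with hlt | hge
    · exact ⟨S, subset_rfl, hS, hlt, rfl⟩
    · obtain ⟨P, hPS, hP, hPt⟩ := exists_measurable_subset_measureReal_eq hS (hSE.trans hE1) ht hge
      have hd := measureReal_sdiff_of_subset_Icc hP (hSE.trans hE1) hPS
      push_cast at hn
      obtain ⟨T, hTS, hT, hTt, hνT⟩ := ih (hS.diff hP) (Set.sdiff_subset.trans hSE)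
        (by rw [hd, hPt]; linarith)
      refine ⟨T, hTS.trans Set.sdiff_subset, hT, hTt, ?_⟩
      rw [h.sdiff_add hP hS hSE hPS, h0 P (hPS.trans hSE) hP hPt, zero_add, hνT]

/-- A set function that vanishes on all sets of one intermediate mass `w` vanishes. -/
theorem eq_zero_of_forall_measureReal_eq (h : IsAddAbsCont E ν) (hE : MeasurableSet E)
    (hE1 : E ⊆ Set.Icc 0 1) {w : ℝ} (hw : 0 < w) (hwE : w < volume.real E)
    (h0 : ∀ S ⊆ E, MeasurableSet S → volume.real S = w → ν S = 0) {S : Set ℝ}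
    (hS : MeasurableSet S) (hSE : S ⊆ E) : ν S = 0 := by
  have hsmall (n : ℕ) (hn : w / (n + 1) ≤ volume.real E - w) :
      ∀ T ⊆ E, MeasurableSet T → volume.real T = w / (n + 1) → ν T = 0 := by
    intro T hTE hT hTw
    have hn1 : (0 : ℝ) < n + 1 := by positivity
    have htw : w / (n + 1) ≤ w := div_le_self hw.le (by linarith [n.cast_nonneg (α := ℝ)])
    have ht0 : 0 < w / (n + 1) := by positivity
    obtain ⟨R, hRE, hR, hRw⟩ := exists_measurable_subset_measureReal_eq (hE.diff hT)
      (Set.sdiff_subset.trans hE1) (t := w - w / (n + 1)) (by linarith)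
      (by rw [measureReal_sdiff_of_subset_Icc hT hE1 hTE]; linarith)
    have hdTR : Disjoint T R := (Set.disjoint_of_subset_left hRE Set.disjoint_sdiff_left).symm
    have hRE' : R ⊆ E := hRE.trans Set.sdiff_subset
    have hTR : volume.real (T ∪ R) = w := by
      rw [measureReal_union_of_subset_Icc hR (hTE.trans hE1) (hRE'.trans hE1) hdTR, hTw, hRw]
      ring
    refine h.eq_zero_of_exchange hE1 (n := n) hT (hT.union hR) (Set.union_subset hTE hRE')
      Set.subset_union_left (by rw [hTR, hTw]; field_simp)
      (h0 _ (Set.union_subset hTE hRE') (hT.union hR) hTR) fun Q hQ hQm hQT => ?_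
    have hQE : Q ⊆ E := hQ.trans (Set.sdiff_subset.trans (Set.union_subset hTE hRE'))
    have hdTQ : Disjoint T Q := (Set.disjoint_of_subset_left hQ Set.disjoint_sdiff_left).symm
    have hTQ : volume.real (T ∪ Q) = w / (n + 1) + w / (n + 1) := by
      rw [measureReal_union_of_subset_Icc hQm (hTE.trans hE1) (hQE.trans hE1) hdTQ, hQT, hTw]
    obtain ⟨X, hXE, hX, hXw⟩ := exists_measurable_subset_measureReal_eq
      (hE.diff (hT.union hQm))
      (Set.sdiff_subset.trans hE1) (t := w - w / (n + 1)) (by linarith)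
      (by rw [measureReal_sdiff_of_subset_Icc (hT.union hQm) hE1 (Set.union_subset hTE hQE), hTQ]
          linarith)
    have hXE' : X ⊆ E := hXE.trans Set.sdiff_subset
    have hd : Disjoint (T ∪ Q) X :=
      (Set.disjoint_of_subset_left hXE Set.disjoint_sdiff_left).symm
    rw [Set.disjoint_union_left] at hd
    have hval (Y : Set ℝ) (hY : MeasurableSet Y) (hYE : Y ⊆ E) (hYX : Disjoint Y X)
        (hYw : volume.real Y = w / (n + 1)) : ν Y = - ν X := by
      have := h0 (Y ∪ X) (Set.union_subset hYE hXE') (hY.union hX) (by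
        rw [measureReal_union_of_subset_Icc hX (hYE.trans hE1) (hXE'.trans hE1) hYX, hYw, hXw]
        ring)
      rw [h.union Y X hY hX hYE hXE' hYX] at this
      linear_combination this
    rw [hval Q hQm hQE hd.2 (hQT.trans hTw), hval T hT hTE hd.1 hTw]
  by_contra hne
  obtain ⟨δ, hδ, H⟩ := h.small ‖ν S‖ (norm_pos_iff.2 hne)
  obtain ⟨n, hn⟩ := exists_nat_gt (w / min δ (volume.real E - w))
  have hmin : 0 < min δ (volume.real E - w) := lt_min hδ (by linarith)
  have hle : w / (n + 1) ≤ min δ (volume.real E - w) := by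
    rw [div_lt_iff₀ hmin] at hn
    rw [div_le_iff₀ (by positivity)]
    nlinarith
  have ht : 0 < w / ((n : ℝ) + 1) := by positivity
  obtain ⟨k, hk⟩ := exists_nat_gt (volume.real S / (w / ((n : ℝ) + 1)))
  rw [div_lt_iff₀ ht] at hk
  obtain ⟨T, hTS, hT, hTt, hνT⟩ := h.eq_zero_of_small_pieces hE1 ht.le
    (hsmall n (hle.trans (min_le_right _ _))) k hS hSE (by linarith)
  rw [hνT] at H
  exact lt_irrefl _ (H T hT (hTS.trans hSE) (hTt.trans_le (hle.trans (min_le_left _ _))))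

end IsAddAbsCont

lemma ae_eq_zero_of_forall_box {ι : Type*} [Fintype ι] {f : (ι → ℝ) → ℂ} {I : ι → Set ℝ}
    (hI : ∀ i, MeasurableSet (I i)) (hf : IntegrableOn f (Set.univ.pi I))
    (h0 : ∀ C : ι → Set ℝ, (∀ i, MeasurableSet (C i)) → (∀ i, C i ⊆ I i) →
      ∫ x in Set.univ.pi C, f x = 0) :
    f =ᵐ[volume.restrict (Set.univ.pi I)] 0 := by
  have huniv : ∫ x in Set.univ.pi I, f x = 0 := h0 I hI fun _ => subset_rfl
  refine Integrable.ae_eq_zero_of_forall_setIntegral_eq_zero hf fun s hs _ => ?_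
  refine MeasurableSpace.induction_on_inter
    (C := fun s _ => ∫ x in s, f x ∂volume.restrict (Set.univ.pi I) = 0)
    generateFrom_pi.symm isPiSystem_pi (by simp) ?_ ?_ ?_ s hs
  · rintro _ ⟨C, hC, rfl⟩
    have hC' : ∀ i, MeasurableSet (C i) := fun i => hC i (Set.mem_univ i)
    rw [Measure.restrict_restrict (MeasurableSet.univ_pi hC'), ← Set.pi_inter_distrib]
    exact h0 _ (fun i => (hC' i).inter (hI i)) fun i => Set.inter_subset_right
  · intro t ht ih
    have := integral_add_compl ht hf
    rwa [ih, huniv, zero_add] at this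
  · intro g hd hg ih
    rw [integral_iUnion hg hd hf.integrableOn]
    simp [ih]

lemma volume_setOf_apply_eq_apply {ι : Type*} [Fintype ι] {i j : ι} (hij : i ≠ j) :
    volume {x : ι → ℝ | x i = x j} = 0 := by
  classical
  have := Measure.addHaar_submodule volume
    (LinearMap.ker (LinearMap.proj (R := ℝ) (φ := fun _ : ι => ℝ) i - LinearMap.proj j)) ?_
  · convert this using 2
    ext x
    simp [sub_eq_zero]
  · intro h
    have : Pi.single i (1 : ℝ) ∈ (⊤ : Submodule ℝ (ι → ℝ)) := trivial
    rw [← h] at this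
    simp [hij.symm] at this

lemma ae_eq_zero_of_forall_disjoint_box {ι : Type*} [Fintype ι] {f : (ι → ℝ) → ℂ} {α : ι → ℝ}
    (hα : ∀ i, 0 < α i) (hf : IntegrableOn f (Set.univ.pi fun _ => Set.Icc 0 1))
    (h0 : ∀ A : ι → Set ℝ, (∀ i, MeasurableSet (A i)) → (∀ i, A i ⊆ Set.Icc 0 1) →
      Pairwise (fun i j => Disjoint (A i) (A j)) → (∀ i, volume.real (A i) ≤ α i) →
      ∫ x in Set.univ.pi A, f x = 0) :
    f =ᵐ[volume.restrict (Set.univ.pi fun _ => Set.Icc (0 : ℝ) 1)] 0 := by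
  set K : Set (ι → ℝ) := Set.univ.pi fun _ => Set.Icc (0 : ℝ) 1 with hK
  have hKm : MeasurableSet K := MeasurableSet.univ_pi fun _ => measurableSet_Icc
  set s : Set (ι → ℝ) := {x | x ∈ K ∧ Function.Injective x ∧ f x ≠ 0} with hs
  have hs0 : volume s = 0 := by
    refine measure_null_of_locally_null s fun x hx => ?_
    have hev : ∀ᶠ δ in nhdsWithin (0 : ℝ) (Set.Ioi 0),
        (∀ i, 2 * δ < α i) ∧ (∀ i j, i ≠ j → 2 * δ < dist (x i) (x j)) := by
      have ht : Tendsto (fun δ : ℝ => 2 * δ) (nhdsWithin (0 : ℝ) (Set.Ioi 0)) (nhds 0) := by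
        have : Tendsto (fun δ : ℝ => 2 * δ) (nhds 0) (nhds (2 * 0)) :=
          (continuous_const.mul continuous_id).tendsto 0
        rw [mul_zero] at this
        exact this.mono_left nhdsWithin_le_nhds
      refine (eventually_all.2 fun i => ht.eventually_lt_const (hα i)).and
        (eventually_all.2 fun i => eventually_all.2 fun j => ?_)
      by_cases hij : i = j
      · simp [hij]
      · filter_upwards [ht.eventually_lt_const (dist_pos.2 (hx.2.1.ne hij))] with δ h _ using h
    obtain ⟨δ, ⟨hδα, hδ⟩, hδ0⟩ := (hev.and self_mem_nhdsWithin).exists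
    have hδ0 : 0 < δ := hδ0
    set I : ι → Set ℝ := fun i => Metric.ball (x i) δ ∩ Set.Icc 0 1 with hI
    have hIm : ∀ i, MeasurableSet (I i) := fun i => measurableSet_ball.inter measurableSet_Icc
    have hIK : Set.univ.pi I ⊆ K := Set.pi_mono fun i _ => Set.inter_subset_right
    have hae := ae_eq_zero_of_forall_box hIm (hf.mono_set hIK) fun C hC hCI => by
      refine h0 C hC (fun i => (hCI i).trans Set.inter_subset_right) (fun i j hij => ?_) fun i => ?_
      · refine Set.disjoint_of_subset ((hCI i).trans Set.inter_subset_left)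
          ((hCI j).trans Set.inter_subset_left) (Metric.ball_disjoint_ball ?_)
        linarith [hδ i j hij]
      · refine (measureReal_mono ((hCI i).trans Set.inter_subset_left) measure_ball_lt_top.ne).trans ?_
        rw [Real.volume_real_ball hδ0.le]
        exact (hδα i).le
    refine ⟨(Set.univ.pi fun i => Metric.ball (x i) δ) ∩ s, inter_mem (mem_nhdsWithin_of_mem_nhds
      (set_pi_mem_nhds Set.finite_univ fun i _ => Metric.ball_mem_nhds _ hδ0))
      self_mem_nhdsWithin, ?_⟩
    rw [EventuallyEq, ae_restrict_iff' (MeasurableSet.univ_pi hIm)] at hae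
    refine measure_mono_null (fun y hy => ?_) hae
    simp only [Set.mem_compl_iff, Set.mem_ofPred_eq, Classical.not_imp]
    exact ⟨fun i _ => ⟨hy.1 i trivial, hy.2.1 i trivial⟩, hy.2.2.2⟩
  have hd0 : volume (⋃ i : ι, ⋃ j : ι, ⋃ _ : i ≠ j, {x : ι → ℝ | x i = x j}) = 0 := by
    simp only [measure_iUnion_null_iff]
    exact fun i j hij => volume_setOf_apply_eq_apply hij
  rw [EventuallyEq, ae_restrict_iff' hKm]
  refine measure_mono_null (fun y hy => ?_) (measure_union_null hs0 hd0)
  simp only [Set.mem_compl_iff, Set.mem_ofPred_eq, Classical.not_imp] at hy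
  by_cases hinj : Function.Injective y
  · exact Or.inl ⟨hy.1, hinj, hy.2⟩
  · right
    simp only [Function.Injective, not_forall] at hinj
    obtain ⟨i, j, hij, hne⟩ := hinj
    simp only [Set.mem_iUnion]
    exact ⟨i, j, hne, hij⟩

/-- The integral of `f` over the box with sides `A i`. -/
noncomputable def boxIntegral {ι : Type*} [Fintype ι] (f : (ι → ℝ) → ℂ) (A : ι → Set ℝ) : ℂ :=
  ∫ x in Set.univ.pi A, f x

lemma isAddAbsCont_boxIntegral {ι : Type*} [Fintype ι] [DecidableEq ι] {f : (ι → ℝ) → ℂ}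
    (hf : IntegrableOn f (Set.univ.pi fun _ => Set.Icc 0 1)) {A : ι → Set ℝ}
    (hA : ∀ i, MeasurableSet (A i)) (hA1 : ∀ i, A i ⊆ Set.Icc 0 1) (k : ι) :
    IsAddAbsCont (Set.Icc 0 1) (fun S => boxIntegral f (Function.update A k S)) := by
  have hm {S : Set ℝ} (hS : MeasurableSet S) :
      MeasurableSet (Set.univ.pi (Function.update A k S)) := by
    refine MeasurableSet.univ_pi fun i => ?_
    rcases eq_or_ne i k with rfl | h
    · simpa
    · simpa [h] using hA i
  have hsub {S : Set ℝ} (hS : S ⊆ Set.Icc 0 1) :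
      Set.univ.pi (Function.update A k S) ⊆ Set.univ.pi fun _ => Set.Icc 0 1 := by
    refine Set.pi_mono fun i _ => ?_
    rcases eq_or_ne i k with rfl | h
    · simpa
    · simpa [h] using hA1 i
  have hform (S : Set ℝ) : Set.univ.pi (Function.update A k S) =
      {x | x k ∈ S} ∩ Set.pi {k}ᶜ A := Set.univ_pi_update k A S fun _ t => t
  constructor
  · intro S T hS hT hS1 hT1 hd
    have hunion : Set.univ.pi (Function.update A k (S ∪ T)) =
        Set.univ.pi (Function.update A k S) ∪ Set.univ.pi (Function.update A k T) := by
      simp only [hform, ← Set.union_inter_distrib_right]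
      rfl
    simp only [boxIntegral, hunion]
    refine setIntegral_union ?_ (hm hT) (hf.mono_set (hsub hS1)) (hf.mono_set (hsub hT1))
    simp only [hform]
    exact Set.disjoint_left.2 fun x hx hx' => Set.disjoint_left.1 hd hx.1 hx'.1
  · intro ε hε
    obtain ⟨δ, hδ, H⟩ := exists_pos_setLIntegral_lt_of_measure_lt hf.2.ne
      (ENNReal.ofReal_pos.2 hε).ne'
    have hδ' : 0 < min δ 1 := lt_min hδ one_pos
    have hδt : min δ 1 ≠ ⊤ := ne_top_of_le_ne_top ENNReal.one_ne_top (min_le_right _ _)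
    refine ⟨(min δ 1).toReal, ENNReal.toReal_pos hδ'.ne' hδt, fun S hS hS1 hlt => ?_⟩
    have hSt : volume S ≠ ⊤ := measure_ne_top_of_subset hS1 (by simp)
    have hvol : volume (Set.univ.pi (Function.update A k S)) ≤ volume S := by
      rw [volume_pi_pi, ← Finset.mul_prod_erase _ _ (Finset.mem_univ k), Function.update_self]
      refine mul_le_of_le_one_right' (Finset.prod_le_one' fun i hi => ?_)
      rw [Function.update_of_ne (Finset.ne_of_mem_erase hi)]
      exact (measure_mono (hA1 i)).trans (by simp)
    have hltδ : volume (Set.univ.pi (Function.update A k S)) < δ :=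
      hvol.trans_lt (((ENNReal.toReal_lt_toReal hSt hδt).1 hlt).trans_le (min_le_left _ _))
    have := H _ ((Measure.restrict_apply_le _ _).trans_lt hltδ)
    rw [Measure.restrict_restrict (hm hS), Set.inter_eq_left.2 (hsub hS1)] at this
    have h2 := (enorm_integral_le_lintegral_enorm (μ := volume.restrict
      (Set.univ.pi (Function.update A k S))) f).trans_lt this
    rwa [← ofReal_norm, ENNReal.ofReal_lt_ofReal_iff hε] at h2

lemma boxIntegral_comp_perm {ι : Type*} [Fintype ι] {f : (ι → ℝ) → ℂ}
    {σ : Equiv.Perm ι} (hf : ∀ x : ι → ℝ, f (fun i => x (σ i)) = f x) (A : ι → Set ℝ) :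
    boxIntegral f (fun i => A (σ i)) = boxIntegral f A := by
  have hmp := volume_measurePreserving_piCongrLeft (fun _ : ι => ℝ) σ
  have key := hmp.setIntegral_preimage_emb (MeasurableEquiv.measurableEmbedding _) f
    (Set.univ.pi A)
  have hval (x : ι → ℝ) (i : ι) :
      MeasurableEquiv.piCongrLeft (fun _ : ι => ℝ) σ x (σ i) = x i :=
    Equiv.piCongrLeft_apply_apply (P := fun _ : ι => ℝ) σ x i
  have hfx (x : ι → ℝ) : f (MeasurableEquiv.piCongrLeft (fun _ : ι => ℝ) σ x) = f x := by
    rw [← hf]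
    simp only [hval]
  have hpre : (MeasurableEquiv.piCongrLeft (fun _ : ι => ℝ) σ) ⁻¹' (Set.univ.pi A) =
      Set.univ.pi fun i => A (σ i) := by
    ext x
    simp only [Set.mem_preimage, Set.mem_univ_pi]
    rw [← σ.forall_congr_right]
    simp only [hval]
  simp only [boxIntegral]
  rw [← key, hpre]
  simp only [hfx]

/-- If a symmetric biadditive set function vanishes on all splittings of `W` into parts of masses
`a < b`, then it vanishes on disjoint sets of masses `a` and `b / (n + 1)`, for large `n`. -/
lemma eq_zero_of_symm_of_forall_split {G : Set ℝ → Set ℝ → ℂ} {W : Set ℝ} {a b p : ℝ} {n : ℕ}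
    (hW : MeasurableSet W) (hW1 : W ⊆ Set.Icc 0 1) (hWab : volume.real W = a + b)
    (hG : ∀ Y ⊆ W, MeasurableSet Y → IsAddAbsCont W fun X => G X Y)
    (hsymm : ∀ X Y, G X Y = G Y X)
    (h0 : ∀ X ⊆ W, ∀ Y ⊆ W, MeasurableSet X → MeasurableSet Y → Disjoint X Y →
      volume.real X = a → volume.real Y = b → G X Y = 0)
    (hab : a < b) (hpa : p < a) (hn : b = (n + 1) * p)
    {S P : Set ℝ} (hS : MeasurableSet S) (hP : MeasurableSet P) (hSW : S ⊆ W) (hPW : P ⊆ W)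
    (hSP : Disjoint S P) (hSa : volume.real S = a) (hPp : volume.real P = p) :
    G S P = 0 := by
  have hG' (X : Set ℝ) (hXW : X ⊆ W) (hX : MeasurableSet X) : IsAddAbsCont W fun Y => G X Y := by
    simpa only [hsymm X] using hG X hXW hX
  have hTS : volume.real (W \ S) = b := by
    rw [measureReal_sdiff_of_subset_Icc hS hW1 hSW, hWab, hSa]
    ring
  have hPT : P ⊆ W \ S := Set.subset_sdiff.2 ⟨hPW, hSP.symm⟩
  refine (hG' S hSW hS).eq_zero_of_exchange hW1 (n := n) hP (hW.diff hS) Set.sdiff_subset hPT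
    (by rw [hTS, hPp, hn])
    (h0 S hSW _ Set.sdiff_subset hS (hW.diff hS) Set.disjoint_sdiff_right hSa hTS)
    fun Q hQ hQm hQP => ?_
  have hQW : Q ⊆ W := hQ.trans (Set.sdiff_subset.trans Set.sdiff_subset)
  have hQS : Disjoint S Q := (Set.disjoint_of_subset_left (hQ.trans Set.sdiff_subset)
    Set.disjoint_sdiff_left).symm
  have hQPd : Disjoint P Q := (Set.disjoint_of_subset_left hQ Set.disjoint_sdiff_left).symm
  rw [hPp] at hQP
  have hPQ : volume.real (P ∪ Q) = 2 * p := by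
    rw [measureReal_union_of_subset_Icc hQm (hPW.trans hW1) (hQW.trans hW1) hQPd, hPp, hQP]
    ring
  set V := W \ (P ∪ Q) with hV
  have hVm : MeasurableSet V := hW.diff (hP.union hQm)
  have hVW : V ⊆ W := Set.sdiff_subset
  have hV1 : V ⊆ Set.Icc 0 1 := hVW.trans hW1
  have hVr : volume.real V = a + b - 2 * p := by
    rw [measureReal_sdiff_of_subset_Icc (hP.union hQm) hW1 (Set.union_subset hPW hQW), hWab, hPQ]
  have hVd (X : Set ℝ) (hX : X ⊆ V) : Disjoint X P ∧ Disjoint X Q :=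
    Set.disjoint_union_right.1 (Set.disjoint_of_subset_left hX Set.disjoint_sdiff_left)
  have hD : IsAddAbsCont V fun X => G X Q - G X P := ((hG Q hQW hQm).sub (hG P hPW hP)).mono hVW
  have expand (X Y P Q : Set ℝ) (hX : MeasurableSet X) (hXV : X ⊆ W) (hY : MeasurableSet Y)
      (hYV : Y ⊆ W) (hP : MeasurableSet P) (hPW : P ⊆ W) (hQ : MeasurableSet Q) (hQW : Q ⊆ W)
      (hXP : Disjoint X P) (hYQ : Disjoint Y Q) :
      G (X ∪ P) (Y ∪ Q) = G X Y + G X Q + (G P Y + G P Q) := by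
    rw [(hG (Y ∪ Q) (Set.union_subset hYV hQW) (hY.union hQ)).union X P hX hP hXV hPW hXP,
      (hG' X hXV hX).union Y Q hY hQ hYV hQW hYQ, (hG' P hPW hP).union Y Q hY hQ hYV hQW hYQ]
  have hflip (R : Set ℝ) (hR : MeasurableSet R) (hRV : R ⊆ V) (hRr : volume.real R = a - p) :
      G R Q - G R P = G (V \ R) Q - G (V \ R) P := by
    have hU : MeasurableSet (V \ R) := hVm.diff hR
    have hUV : V \ R ⊆ V := Set.sdiff_subset
    have hUr : volume.real (V \ R) = b - p := by
      rw [measureReal_sdiff_of_subset_Icc hR hV1 hRV, hVr, hRr]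
      ring
    have hRU : Disjoint R (V \ R) := Set.disjoint_sdiff_right
    have hzero (P Q : Set ℝ) (hP : MeasurableSet P) (hPW : P ⊆ W) (hQ : MeasurableSet Q)
        (hQW : Q ⊆ W) (hPQ : Disjoint P Q) (hVP : ∀ X ⊆ V, Disjoint X P)
        (hVQ : ∀ X ⊆ V, Disjoint X Q) (hPp : volume.real P = p) (hQp : volume.real Q = p) :
        G R (V \ R) + G R Q + (G P (V \ R) + G P Q) = 0 := by
      rw [← expand R (V \ R) P Q hR (hRV.trans hVW) hU (hUV.trans hVW) hP hPW hQ hQW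
        (hVP R hRV) (hVQ _ hUV)]
      refine h0 _ (Set.union_subset (hRV.trans hVW) hPW) _
        (Set.union_subset (hUV.trans hVW) hQW) (hR.union hP) (hU.union hQ) ?_ ?_ ?_
      · rw [Set.disjoint_union_left, Set.disjoint_union_right, Set.disjoint_union_right]
        exact ⟨⟨hRU, hVQ R hRV⟩, (hVP _ hUV).symm, hPQ⟩
      · rw [measureReal_union_of_subset_Icc hP (hRV.trans hV1) (hPW.trans hW1) (hVP R hRV), hRr,
          hPp]
        ring
      · rw [measureReal_union_of_subset_Icc hQ (hUV.trans hV1) (hQW.trans hW1) (hVQ _ hUV), hUr,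
          hQp]
        ring
    have h1 := hzero P Q hP hPW hQm hQW hQPd (fun X hX => (hVd X hX).1) (fun X hX => (hVd X hX).2)
      hPp hQP
    have h2 := hzero Q P hQm hQW hP hPW hQPd.symm (fun X hX => (hVd X hX).2)
      (fun X hX => (hVd X hX).1) hQP hPp
    rw [hsymm P (V \ R)] at h1
    rw [hsymm Q (V \ R), hsymm Q P] at h2
    linear_combination h1 - h2
  have hDS := hD.eq_zero_of_forall_measureReal_eq hVm hV1 (sub_pos.2 hab) (by rw [hVr]; linarith)
    (fun X hXV hX hXr => ?_) hS (Set.subset_sdiff.2 ⟨hSW, Set.disjoint_union_right.2 ⟨hSP, hQS⟩⟩)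
  · exact sub_eq_zero.1 hDS
  · have hVX : volume.real (V \ X) = 2 * (a - p) := by
      rw [measureReal_sdiff_of_subset_Icc hX hV1 hXV, hVr, hXr]
      ring
    obtain ⟨R, hRVX, hR, hRr⟩ := exists_measurable_subset_measureReal_eq (hVm.diff hX)
      (Set.sdiff_subset.trans hV1) (t := a - p) (by linarith) (by rw [hVX]; linarith)
    have hRV : R ⊆ V := hRVX.trans Set.sdiff_subset
    have hXR : Disjoint X R := (Set.disjoint_of_subset_left hRVX Set.disjoint_sdiff_left).symm
    set R' := (V \ X) \ R with hR'
    have hR'm : MeasurableSet R' := (hVm.diff hX).diff hR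
    have hR'V : R' ⊆ V := Set.sdiff_subset.trans Set.sdiff_subset
    have hR'r : volume.real R' = a - p := by
      rw [measureReal_sdiff_of_subset_Icc hR (Set.sdiff_subset.trans hV1) hRVX, hVX, hRr]
      ring
    have hXR' : Disjoint X R' := (Set.disjoint_of_subset_left Set.sdiff_subset
      Set.disjoint_sdiff_left).symm
    have e1 : V \ R = X ∪ R' := by
      ext z
      have h1 := @hXV z
      have h2 := @Set.disjoint_left.1 hXR z
      simp only [hR', Set.mem_sdiff, Set.mem_union]
      tauto
    have e2 : V \ R' = X ∪ R := by
      ext z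
      have h1 := @hXV z
      have h2 := @hRV z
      simp only [hR', Set.mem_sdiff, Set.mem_union]
      tauto
    have f1 := hflip R hR hRV hRr
    have f2 := hflip R' hR'm hR'V hR'r
    have u1 := hD.union X R' hX hR'm hXV hR'V hXR'
    have u2 := hD.union X R hX hR hXV hRV hXR
    rw [e1] at f1
    rw [e2] at f2
    linear_combination (-1 / 2 : ℂ) * (f1 + f2 + u1 + u2)

section Box

variable {ι : Type*} [Fintype ι] [DecidableEq ι]

/-- The part of the unit interval that is not covered by the `A j` with `j ≠ k`. -/
def freePart (A : ι → Set ℝ) (k : ι) : Set ℝ :=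
  Set.Icc 0 1 \ ⋃ j ∈ Finset.univ.erase k, A j

/-- `A` is a family of disjoint measurable subsets of the unit interval. -/
structure IsPacking (A : ι → Set ℝ) : Prop where
  meas : ∀ i, MeasurableSet (A i)
  sub : ∀ i, A i ⊆ Set.Icc 0 1
  disj : Pairwise fun i j => Disjoint (A i) (A j)

lemma freePart_subset (A : ι → Set ℝ) (k : ι) : freePart A k ⊆ Set.Icc 0 1 := Set.sdiff_subset

lemma disjoint_freePart (A : ι → Set ℝ) {j k : ι} (hj : j ≠ k) : Disjoint (A j) (freePart A k) :=
  Set.disjoint_of_subset_left (Set.subset_biUnion_of_mem (u := A)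
    (show j ∈ Finset.univ.erase k by simpa using hj)) Set.disjoint_sdiff_right

namespace IsPacking

variable {A : ι → Set ℝ}

lemma measurableSet_freePart (hA : IsPacking A) (k : ι) : MeasurableSet (freePart A k) :=
  measurableSet_Icc.diff (Finset.measurableSet_biUnion _ fun j _ => hA.meas j)

lemma subset_freePart (hA : IsPacking A) (k : ι) : A k ⊆ freePart A k := by
  refine Set.subset_sdiff.2 ⟨hA.sub k, ?_⟩
  simp only [Set.disjoint_iUnion_right]
  exact fun j hj => hA.disj (Finset.ne_of_mem_erase hj).symm

lemma measureReal_freePart (hA : IsPacking A) (k : ι) :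
    volume.real (freePart A k) = 1 - ∑ j ∈ Finset.univ.erase k, volume.real (A j) := by
  rw [freePart, measureReal_sdiff_of_subset_Icc
    (Finset.measurableSet_biUnion _ fun j _ => hA.meas j) subset_rfl
    (Set.iUnion₂_subset fun j _ => hA.sub j),
    measureReal_biUnion_finset (fun i _ j _ hij => hA.disj hij) (fun j _ => hA.meas j)
      fun j _ => measure_ne_top_of_subset (hA.sub j) (by simp)]
  simp

lemma update (hA : IsPacking A) {k : ι} {S : Set ℝ} (hS : MeasurableSet S)
    (hSE : S ⊆ freePart A k) : IsPacking (Function.update A k S) where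
  meas i := by
    rcases eq_or_ne i k with rfl | h
    · simpa
    · simpa [h] using hA.meas i
  sub i := by
    rcases eq_or_ne i k with rfl | h
    · simpa using hSE.trans (freePart_subset A i)
    · simpa [h] using hA.sub i
  disj i j hij := by
    rcases eq_or_ne i k with rfl | hi
    · simpa [hij.symm] using
        (Set.disjoint_of_subset_right hSE (disjoint_freePart A hij.symm)).symm
    · rcases eq_or_ne j k with rfl | hj
      · simpa [hij] using Set.disjoint_of_subset_right hSE (disjoint_freePart A hij)
      · simpa [hi, hj] using hA.disj hij

end IsPacking

lemma boxIntegral_eq_zero_of_le {f : (ι → ℝ) → ℂ} {α : ι → ℝ} (hα : ∀ i, 0 < α i)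
    (hsum : ∑ i, α i < 1) (hf : IntegrableOn f (Set.univ.pi fun _ => Set.Icc 0 1))
    (h0 : ∀ A, IsPacking A → (∀ i, volume.real (A i) = α i) → boxIntegral f A = 0)
    {A : ι → Set ℝ} (hA : IsPacking A) (hle : ∀ i, volume.real (A i) ≤ α i) :
    boxIntegral f A = 0 := by
  have key (s : Finset ι) : ∀ A, IsPacking A → (∀ i ∈ s, volume.real (A i) ≤ α i) →
      (∀ i ∉ s, volume.real (A i) = α i) → boxIntegral f A = 0 := by
    induction s using Finset.induction_on with
    | empty => exact fun A hA _ h => h0 A hA fun i => h i (by simp)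
    | insert k s hk ih =>
      intro A hA hle heq
      have hle' (i : ι) : volume.real (A i) ≤ α i := by
        by_cases hi : i ∈ insert k s
        · exact hle i hi
        · exact (heq i hi).le
      have hν := (isAddAbsCont_boxIntegral hf hA.meas hA.sub k).mono (freePart_subset A k)
      have hlt : α k < volume.real (freePart A k) := by
        rw [hA.measureReal_freePart k]
        rw [← Finset.add_sum_erase _ _ (Finset.mem_univ k)] at hsum
        linarith [Finset.sum_le_sum fun i (_ : i ∈ Finset.univ.erase k) => hle' i]
      have := hν.eq_zero_of_forall_measureReal_eq (hA.measurableSet_freePart k)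
        (freePart_subset A k) (hα k) hlt (fun S hSE hS hSα => ?_) (hA.meas k) (hA.subset_freePart k)
      · simpa using this
      · refine ih _ (hA.update hS hSE) (fun i hi => ?_) fun i hi => ?_
        · have hik : i ≠ k := fun h => hk (h ▸ hi)
          simpa [hik] using hle i (Finset.mem_insert_of_mem hi)
        · rcases eq_or_ne i k with rfl | hik
          · simpa using hSα
          · simpa [hik] using heq i (by simp [hik, hi])
  exact key Finset.univ A hA (fun i _ => hle i) fun i hi => absurd (Finset.mem_univ i) hi

lemma boxIntegral_eq_zero_of_symm {f : (ι → ℝ) → ℂ} {α : ι → ℝ} (hsum : ∑ i, α i = 1)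
    (hf : IntegrableOn f (Set.univ.pi fun _ => Set.Icc 0 1))
    (hsymm : ∀ (σ : Equiv.Perm ι) (x : ι → ℝ), f (fun i => x (σ i)) = f x)
    (h0 : ∀ A, IsPacking A → (∀ i, volume.real (A i) = α i) → boxIntegral f A = 0)
    {i j : ι} (hij : α i < α j) {p : ℝ} {n : ℕ} (hpa : p < α i)
    (hn : α j = (n + 1) * p) {A : ι → Set ℝ} (hA : IsPacking A)
    (hAα : ∀ l, volume.real (A l) = Function.update α j p l) : boxIntegral f A = 0 := by
  have hne : i ≠ j := by rintro rfl; exact lt_irrefl _ hij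
  set B := Function.update A j ∅ with hB
  have hBp : IsPacking B := hA.update MeasurableSet.empty (Set.empty_subset _)
  have hBα (l : ι) : volume.real (B l) = Function.update α j 0 l := by
    rcases eq_or_ne l j with rfl | h
    · simp [hB]
    · simpa [hB, h] using hAα l
  set W := freePart B i with hWdef
  set G : Set ℝ → Set ℝ → ℂ := fun X Y =>
    boxIntegral f (Function.update (Function.update B i X) j Y) with hGdef
  have hWr : volume.real W = α i + α j := by
    rw [hBp.measureReal_freePart i, Finset.sum_congr rfl fun l _ => hBα l]
    have e := Finset.add_sum_erase Finset.univ α (Finset.mem_univ i)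
    have hj : j ∈ Finset.univ.erase i := by simpa using hne.symm
    rw [← Finset.add_sum_erase _ α hj, hsum] at e
    rw [← Finset.add_sum_erase _ (Function.update α j 0) hj, Function.update_self,
      Finset.sum_congr rfl fun l hl =>
        Function.update_of_ne (Finset.ne_of_mem_erase hl) (0 : ℝ) α]
    linarith
  have hpack {X Y : Set ℝ} (hX : MeasurableSet X) (hXW : X ⊆ W) (hY : MeasurableSet Y)
      (hYW : Y ⊆ W) (hXY : Disjoint X Y) :
      IsPacking (Function.update (Function.update B i X) j Y) := by
    refine (hBp.update hX hXW).update hY (Set.subset_sdiff.2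
      ⟨hYW.trans (freePart_subset _ _), ?_⟩)
    simp only [Set.disjoint_iUnion_right]
    intro l _
    rcases eq_or_ne l i with rfl | h
    · simpa using hXY.symm
    · simpa [h] using (Set.disjoint_of_subset_right hYW (disjoint_freePart B h)).symm
  have hGsymm (X Y : Set ℝ) : G X Y = G Y X := by
    rw [hGdef]
    simp only
    rw [← boxIntegral_comp_perm (hsymm (Equiv.swap i j))
      (Function.update (Function.update B i Y) j X)]
    congr 1
    funext l
    rcases eq_or_ne l i with rfl | hli
    · simp [hne]
    · rcases eq_or_ne l j with rfl | hlj
      · simp [hne]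
      · simp [hli, hlj, Equiv.swap_apply_of_ne_of_ne hli hlj]
  have hGadd (Y : Set ℝ) (hYW : Y ⊆ W) (hY : MeasurableSet Y) :
      IsAddAbsCont W fun X => G X Y := by
    have hm (l : ι) : MeasurableSet (Function.update B j Y l) := by
      rcases eq_or_ne l j with rfl | h
      · simpa
      · simpa [h] using hBp.meas l
    have hs (l : ι) : Function.update B j Y l ⊆ Set.Icc 0 1 := by
      rcases eq_or_ne l j with rfl | h
      · simpa using hYW.trans (freePart_subset B i)
      · simpa [h] using hBp.sub l
    simpa only [hGdef, Function.update_comm hne] using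
      (isAddAbsCont_boxIntegral hf hm hs i).mono (freePart_subset B i)
  have hABe : A = Function.update (Function.update B i (A i)) j (A j) := by
    funext l
    rcases eq_or_ne l j with rfl | hlj
    · simp
    · rcases eq_or_ne l i with rfl | hli
      · simp [hlj]
      · simp [hB, hli, hlj]
  have hAiW : A i ⊆ W := by simpa [hB, hne] using hBp.subset_freePart i
  have hAjW : A j ⊆ W := by
    refine Set.subset_sdiff.2 ⟨hA.sub j, ?_⟩
    simp only [Set.disjoint_iUnion_right]
    intro l _
    rcases eq_or_ne l j with rfl | h
    · simp [hB]
    · simpa [hB, h] using hA.disj h.symm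
  rw [hABe]
  refine eq_zero_of_symm_of_forall_split (G := G) (hBp.measurableSet_freePart i)
    (freePart_subset B i) hWr hGadd hGsymm (fun X hXW Y hYW hX hY hXY hXa hYb => ?_) hij hpa hn
    (hA.meas i) (hA.meas j) hAiW hAjW (hA.disj hne) (by simpa [hne] using hAα i)
    (by simpa using hAα j)
  refine h0 _ (hpack hX hXW hY hYW hXY) fun l => ?_
  rcases eq_or_ne l j with rfl | hlj
  · simpa using hYb
  · rcases eq_or_ne l i with rfl | hli
    · simpa [hlj] using hXa
    · simpa [hli, hlj] using hBα l

lemma ae_eq_zero_of_forall_packing {f : (ι → ℝ) → ℂ} {α : ι → ℝ} (hα : ∀ i, 0 < α i)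
    (hsum : ∑ i, α i < 1) (hf : IntegrableOn f (Set.univ.pi fun _ => Set.Icc 0 1))
    (h0 : ∀ A, IsPacking A → (∀ i, volume.real (A i) = α i) → boxIntegral f A = 0) :
    f =ᵐ[volume.restrict (Set.univ.pi fun _ => Set.Icc (0 : ℝ) 1)] 0 :=
  ae_eq_zero_of_forall_disjoint_box hα hf fun _ hA hA1 hd hle =>
    boxIntegral_eq_zero_of_le hα hsum hf h0 ⟨hA, hA1, hd⟩ hle

end Box

/-- **Lemma (L3+).** Let `α_i ∈ (0,1)` with `∑ α_i ≤ 1`, and let `f` be integrable on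
`[0,1]^m` with `∫_{A₁×⋯×A_m} f = 0` for all pairwise disjoint measurable `A_i ⊆ [0,1]`
with `λ(A_i) = α_i`. If either `∑ α_i < 1`, or `∑ α_i = 1`, `(α) ≠ (1/m,…,1/m)` and `f`
is symmetric, then `f = 0` a.e. -/
theorem stmt9 (m : ℕ) (hm : 1 ≤ m) (α : Fin m → ℝ) (hα : ∀ i, α i ∈ Set.Ioo (0 : ℝ) 1)
    (hsum : ∑ i, α i ≤ 1) (f : (Fin m → ℝ) → ℂ)
    (hint : IntegrableOn f (Set.univ.pi fun _ => Set.Icc 0 1))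
    (h0 : ∀ A : Fin m → Set ℝ, (∀ i, MeasurableSet (A i)) →
        (∀ i, A i ⊆ Set.Icc 0 1) →
        Pairwise (fun i j => Disjoint (A i) (A j)) →
        (∀ i, volume (A i) = ENNReal.ofReal (α i)) →
        ∫ x in Set.univ.pi A, f x = 0)
    (hcase : (∑ i, α i < 1) ∨
      ((∑ i, α i = 1) ∧ (α ≠ fun _ => 1 / (m : ℝ)) ∧
        ∀ (σ : Equiv.Perm (Fin m)) (x : Fin m → ℝ), f (fun i => x (σ i)) = f x)) :
    f =ᵐ[volume.restrict (Set.univ.pi fun _ : Fin m => Set.Icc (0 : ℝ) 1)] 0 := by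
  have h0' : ∀ A, IsPacking A → (∀ i, volume.real (A i) = α i) → boxIntegral f A = 0 := by
    intro A hA hAα
    refine h0 A hA.meas hA.sub hA.disj fun i => ?_
    rw [← hAα i, ofReal_measureReal (measure_ne_top_of_subset (hA.sub i) (by simp))]
  rcases hcase with hlt | ⟨heq, hne, hsymm⟩
  · exact ae_eq_zero_of_forall_packing (fun i => (hα i).1) hlt hint h0'
  obtain ⟨i, j, hij⟩ : ∃ i j, α i < α j := by
    by_contra! hcon
    refine hne (funext fun i => ?_)
    have hm0 : (m : ℝ) ≠ 0 := by exact_mod_cast (by omega : m ≠ 0)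
    rw [Finset.sum_congr rfl fun j _ => le_antisymm (hcon i j) (hcon j i)] at heq
    simp only [sum_const, card_univ, Fintype.card_fin, nsmul_eq_mul] at heq
    field_simp
    linarith
  obtain ⟨n, hn⟩ := exists_nat_gt (α j / α i)
  have hi0 := (hα i).1
  have hj0 := (hα j).1
  have hp0 : 0 < α j / (n + 1) := by positivity
  have hpi : α j / (n + 1) < α i := by
    rw [div_lt_iff₀ hi0] at hn
    rw [div_lt_iff₀ (by positivity)]
    nlinarith
  refine ae_eq_zero_of_forall_packing (α := Function.update α j (α j / (n + 1))) (fun l => ?_) ?_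
    hint fun A hA hAα => boxIntegral_eq_zero_of_symm heq hint hsymm h0' hij hpi
      (by field_simp) hA hAα
  · rcases eq_or_ne l j with rfl | h
    · simpa using hp0
    · simpa [h] using (hα l).1
  · refine (Finset.sum_lt_sum (fun l _ => ?_)
      ⟨j, Finset.mem_univ j, by simpa using hpi.trans hij⟩).trans_eq heq
    rcases eq_or_ne l j with rfl | h
    · simpa using (hpi.trans hij).le
    · simp [h]
end
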